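/- arXiv:1710.10292 — 4 statements merged into one kernel-verified Lean document; each statement's English description precedes it below -/
import Mathlib

section
/- Existence of lexicographic ranking functions for terminating VASSs: Every connected terminating VASS V of dimension n admits a lexicographic ranking function of order at most dim(cone(V)); in particular, of order at most n. -/
namespace VASSPaper

abbrev Val (n : ℕ) := Fin n → ℕ
abbrev Upd (n : ℕ) := Fin n → ℤ
abbrev Transition (n : ℕ) (L : Type) := L × Upd n × L

/-- A vector addition system with states: a finite set of locations and a finite
set of transitions between locations, labelled by integer update vectors. -/
structure VASS (n : ℕ) (L : Type) where
  Locs : Finset L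
  Trns : Finset (Transition n L)
  valid : ∀ t ∈ Trns, t.1 ∈ Locs ∧ t.2.2 ∈ Locs

variable {n : ℕ} {L : Type}

/-- A step of the VASS: the transition is in the system and the (non-negative)
valuation is updated by the update vector. -/
def Step (V : VASS n L) (s : L × Val n) (d : Upd n) (s' : L × Val n) : Prop :=
  (s.1, d, s'.1) ∈ V.Trns ∧ ∀ i, (s'.2 i : ℤ) = (s.2 i : ℤ) + d i

/-- An infinite trace. -/
def InfTrace (V : VASS n L) (ℓ : ℕ → L) (v : ℕ → Val n) (d : ℕ → Upd n) : Prop :=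
  ∀ i, Step V (ℓ i, v i) (d i) (ℓ (i + 1), v (i + 1))

/-- A finite trace of length `k`. -/
def FinTrace (V : VASS n L) (k : ℕ) (ℓ : ℕ → L) (v : ℕ → Val n) (d : ℕ → Upd n) : Prop :=
  ∀ i < k, Step V (ℓ i, v i) (d i) (ℓ (i + 1), v (i + 1))

/-- `V` is terminating if it has no infinite trace. -/
def Terminating (V : VASS n L) : Prop := ¬ ∃ ℓ v d, InfTrace V ℓ v d

/-- A path, given as a list of transitions of `V` with matching endpoints. -/
def IsPath (V : VASS n L) (π : List (Transition n L)) : Prop :=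
  (∀ t ∈ π, t ∈ V.Trns) ∧ π.Chain' (fun t₁ t₂ => t₁.2.2 = t₂.1)

/-- The value of a path: the sum of its update vectors. -/
def pathVal (π : List (Transition n L)) : Upd n := (π.map (fun t => t.2.1)).sum

/-- A cycle: a non-empty path whose start location equals its end location. -/
def IsCycle (V : VASS n L) (π : List (Transition n L)) : Prop :=
  IsPath V π ∧ π ≠ [] ∧ π.head?.map (fun t => t.1) = π.getLast?.map (fun t => t.2.2)

/-- A multi-cycle: a finite collection of cycles. -/
def IsMultiCycle (V : VASS n L) (M : List (List (Transition n L))) : Prop :=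
  ∀ C ∈ M, IsCycle V C

/-- The value of a multi-cycle: the sum of the values of its cycles. -/
def multiVal (M : List (List (Transition n L))) : Upd n := (M.map pathVal).sum

/-- A state is `N`-bounded if each component of its valuation is at most `N`. -/
def NBounded (V : VASS n L) (N : ℕ) (s : L × Val n) : Prop :=
  s.1 ∈ V.Locs ∧ ∀ i, s.2 i ≤ N

/-- `s'` is reachable from `s` by a finite trace. -/
def ReachableFrom (V : VASS n L) (s s' : L × Val n) : Prop :=
  ∃ k ℓ v d, FinTrace V k ℓ v d ∧ (ℓ 0, v 0) = s ∧ (ℓ k, v k) = s'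

/-- The computational complexity: the length of the longest trace starting in an
`N`-bounded state. -/
noncomputable def compN (V : VASS n L) (N : ℕ) : ℕ :=
  sSup { k | ∃ ℓ v d, NBounded V N (ℓ 0, v 0) ∧ FinTrace V k ℓ v d }

/-- A quasi-ranking function: weakly decreasing along every step. -/
def QuasiRanking (V : VASS n L) (q : L × Val n → ℕ) : Prop :=
  ∀ s d s', Step V s d s' → q s' ≤ q s

/-- `q` is ranking for transition `t`: strictly decreasing along every step taken
along `t`. -/
def RankingFor (V : VASS n L) (q : L × Val n → ℕ) (t : Transition n L) : Prop :=
  ∀ s d s', Step V s d s' → (s.1, d, s'.1) = t → q s' < q s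

/-- The (strict) lexicographic order on finite sequences of naturals, as in the paper:
`x >lex y` iff there is an index (within both sequences) where `x` is larger and all
earlier entries agree. -/
def LexGt (x y : List ℕ) : Prop :=
  ∃ i, i < x.length ∧ i < y.length ∧ y.getD i 0 < x.getD i 0 ∧
    ∀ j < i, x.getD j 0 = y.getD j 0

/-- A lexicographic ranking function of order `k` for `V`. -/
def IsLexRankingOfOrder (V : VASS n L) (k : ℕ) (f : L × Val n → List ℕ) : Prop :=
  (∀ s : L × Val n, s.1 ∈ V.Locs → (f s).length ≤ k) ∧
  ∀ s d s', Step V s d s' → LexGt (f s) (f s')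

def SubVASS (S V : VASS n L) : Prop := S.Locs ⊆ V.Locs ∧ S.Trns ⊆ V.Trns

/-- There is a path (possibly empty) from `l` to `l'`. -/
def Reaches (V : VASS n L) (l l' : L) : Prop :=
  Relation.ReflTransGen (fun a b => ∃ d, (a, d, b) ∈ V.Trns) l l'

/-- `V` is connected: every location can reach every other location. -/
def ConnectedV (V : VASS n L) : Prop :=
  ∀ l ∈ V.Locs, ∀ l' ∈ V.Locs, Reaches V l l'

/-- A strongly connected component: a maximal connected sub-VASS. -/
def IsSCC (V S : VASS n L) : Prop :=
  SubVASS S V ∧ ConnectedV S ∧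
    ∀ S', SubVASS S' V → ConnectedV S' → SubVASS S S' → SubVASS S' S

/-- `V` can be fully decomposed into SCCs: every transition belongs to some SCC. -/
def FullyDecomposable (V : VASS n L) : Prop :=
  ∀ t ∈ V.Trns, ∃ S, IsSCC V S ∧ t ∈ S.Trns

/-- The Kosaraju–Sullivan constraints (1)–(3): `Dμ ≥ 0`, `μ ≥ 0` and `Fμ = 0`
(the latter written out entrywise, with the oriented incidence matrix). -/
def NonNegCombo [DecidableEq L] (V : VASS n L) (μ : Transition n L → ℤ) : Prop :=
  (∀ i : Fin n, 0 ≤ ∑ t ∈ V.Trns, t.2.1 i * μ t) ∧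
  (∀ t ∈ V.Trns, 0 ≤ μ t) ∧
  (∀ l ∈ V.Locs,
    ∑ t ∈ V.Trns, ((if t.1 = l then (1 : ℤ) else 0) - (if t.2.2 = l then 1 else 0)) * μ t = 0)

/-- Constraint system (A_t). -/
def SatA [DecidableEq L] (V : VASS n L) (t₀ : Transition n L) : Prop :=
  ∃ μ : Transition n L → ℤ, NonNegCombo V μ ∧ 1 ≤ μ t₀

/-- Constraint system (B_t): `r ≥ 0`, `z ≥ 0` and `Dᵀr + Fᵀz ≤ 0`, with strict
inequality in row `t₀` (the row of `Fᵀz` at a transition `t` is `z(src t) - z(tgt t)`). -/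
def SatB (V : VASS n L) (t₀ : Transition n L) : Prop :=
  ∃ (r : Fin n → ℤ) (z : L → ℤ),
    (∀ i, 0 ≤ r i) ∧ (∀ l ∈ V.Locs, 0 ≤ z l) ∧
    (∀ t ∈ V.Trns, (∑ i, t.2.1 i * r i) + z t.1 - z t.2.2 ≤ 0) ∧
    (∑ i, t₀.2.1 i * r i) + z t₀.1 - z t₀.2.2 < 0

/-- The cone of cycle values of `V` (over ℚ). -/
def coneSet [DecidableEq L] (V : VASS n L) : Set (Fin n → ℚ) :=
  { x | ∃ μ : Transition n L → ℚ, (∀ t ∈ V.Trns, 0 ≤ μ t) ∧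
      (∀ l ∈ V.Locs,
        ∑ t ∈ V.Trns, ((if t.1 = l then (1 : ℚ) else 0) - (if t.2.2 = l then 1 else 0)) * μ t = 0) ∧
      x = fun i => ∑ t ∈ V.Trns, (t.2.1 i : ℚ) * μ t }

/-- The dimension of the smallest vector space containing the cone of `V`. -/
noncomputable def coneDim [DecidableEq L] (V : VASS n L) : ℕ :=
  Module.finrank ℚ (Submodule.span ℚ (coneSet V))

/-- Conservative VASS: the entries of each update vector sum to zero. -/
def Conservative (V : VASS n L) : Prop := ∀ t ∈ V.Trns, ∑ i, t.2.1 i = 0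

/-- The feasible region of the rational LP (C): `ρ ≥ 0`, `Dρ ≥ -1`, `Fρ = 0`. -/
def FeasC [DecidableEq L] (V : VASS n L) (ρ : Transition n L → ℚ) : Prop :=
  (∀ t ∈ V.Trns, 0 ≤ ρ t) ∧
  (∀ i : Fin n, (-1 : ℚ) ≤ ∑ t ∈ V.Trns, (t.2.1 i : ℚ) * ρ t) ∧
  (∀ l ∈ V.Locs,
    ∑ t ∈ V.Trns, ((if t.1 = l then (1 : ℚ) else 0) - (if t.2.2 = l then 1 else 0)) * ρ t = 0)

/-- **Farkas' lemma** for finitely many linear functionals over an ordered field. -/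
theorem farkas {F W ι : Type*} [Field F] [LinearOrder F] [IsStrictOrderedRing F]
    [AddCommGroup W] [Module F W] [DecidableEq ι] (s : Finset ι) (a : ι → W →ₗ[F] F)
    (b : W →ₗ[F] F) (h : ∀ x, (∀ i ∈ s, 0 ≤ a i x) → 0 ≤ b x) :
    ∃ μ : ι → F, (∀ i ∈ s, 0 ≤ μ i) ∧ b = ∑ i ∈ s, μ i • a i := by
  induction s using Finset.induction_on generalizing a b with
  | empty =>
    refine ⟨0, by simp, LinearMap.ext fun x => ?_⟩
    have h₁ := h x (by simp)
    have h₂ := h (-x) (by simp)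
    rw [map_neg] at h₂
    simp only [Finset.sum_empty, LinearMap.zero_apply]
    linarith
  | insert j s hj ih =>
    by_cases hs : ∀ x, (∀ i ∈ s, 0 ≤ a i x) → 0 ≤ b x
    · obtain ⟨μ, hμ, rfl⟩ := ih a b hs
      refine ⟨Function.update μ j 0, fun i hi => ?_, ?_⟩
      · rcases eq_or_ne i j with rfl | hij
        · simp
        · rw [Function.update_of_ne hij]
          exact hμ i (Finset.mem_of_mem_insert_of_ne hi hij)
      · rw [Finset.sum_insert hj, Function.update_self, zero_smul, zero_add]
        refine Finset.sum_congr rfl fun i hi => ?_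
        rw [Function.update_of_ne (ne_of_mem_of_not_mem hi hj)]
    · push Not at hs
      obtain ⟨x, hx, hbx⟩ := hs
      have hjx : a j x < 0 := by
        by_contra! hjx
        exact absurd (h x (by simpa [Finset.forall_mem_insert] using ⟨hjx, hx⟩)) hbx.not_ge
      obtain ⟨y, hy, hby, hjy⟩ : ∃ y, (∀ i ∈ s, 0 ≤ a i y) ∧ b y < 0 ∧ a j y = -1 := by
        have hc : 0 < (-(a j x))⁻¹ := inv_pos.2 (by linarith)
        refine ⟨(-(a j x))⁻¹ • x, fun i hi => ?_, ?_, ?_⟩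
        · rw [map_smul]
          exact mul_nonneg hc.le (hx i hi)
        · rw [map_smul]
          exact mul_neg_of_pos_of_neg hc hbx
        · rw [map_smul, smul_eq_mul]
          rw [inv_neg, neg_mul, inv_mul_cancel₀ hjx.ne]
      obtain ⟨μ, hμ, hb⟩ := ih (fun i => a i + a i y • a j) (b + b y • a j) fun x hx => by
        have := h (x + a j x • y) fun i hi => by
          rcases Finset.mem_insert.1 hi with rfl | hi
          · simp [hjy]
          · simpa [mul_comm] using hx i hi
        simpa [mul_comm] using this
      refine ⟨Function.update μ j (∑ i ∈ s, μ i * a i y - b y), fun i hi => ?_, ?_⟩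
      · rcases eq_or_ne i j with rfl | hij
        · rw [Function.update_self]
          have := Finset.sum_nonneg fun i hi => mul_nonneg (hμ i hi) (hy i hi)
          linarith
        · rw [Function.update_of_ne hij]
          exact hμ i (Finset.mem_of_mem_insert_of_ne hi hij)
      · have hupd : ∀ c : F, ∑ i ∈ s, Function.update μ j c i • a i = ∑ i ∈ s, μ i • a i :=
          fun c => Finset.sum_congr rfl fun i hi => by
            rw [Function.update_of_ne (ne_of_mem_of_not_mem hi hj)]
        rw [Finset.sum_insert hj, Function.update_self, hupd]
        simp only [smul_add, Finset.sum_add_distrib, smul_smul] at hb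
        rw [← Finset.sum_smul] at hb
        linear_combination (norm := module) hb

/-- `Walk V a w b`: the list of transitions `w` of `V` leads from `a` to `b`. -/
def Walk (V : VASS n L) : L → List (Transition n L) → L → Prop
  | a, [], b => a = b
  | a, t :: w, b => t ∈ V.Trns ∧ t.1 = a ∧ Walk V t.2.2 w b

theorem Walk.append {V : VASS n L} {a b c : L} {w w' : List (Transition n L)}
    (h : Walk V a w b) (h' : Walk V b w' c) : Walk V a (w ++ w') c := by
  induction w generalizing a with
  | nil => cases h; exact h'
  | cons t w ih => exact ⟨h.1, h.2.1, ih h.2.2⟩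

theorem Walk.mem_trns {V : VASS n L} {a b : L} {w : List (Transition n L)}
    (h : Walk V a w b) : ∀ t ∈ w, t ∈ V.Trns := by
  induction w generalizing a with
  | nil => simp
  | cons t w ih => simpa [h.1] using ih h.2.2

theorem Reaches.exists_walk {V : VASS n L} {a b : L} (h : Reaches V a b) :
    ∃ w, Walk V a w b := by
  induction h using Relation.ReflTransGen.head_induction_on with
  | refl => exact ⟨[], rfl⟩
  | head h _ ih =>
    obtain ⟨d, hd⟩ := h
    obtain ⟨w, hw⟩ := ih
    exact ⟨_ :: w, hd, rfl, hw⟩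

/-- A walk permutes sources and targets, up to its endpoints. -/
theorem Walk.cons_map_tgt {V : VASS n L} {a b : L} {w : List (Transition n L)}
    (h : Walk V a w b) :
    a ::ₘ (w : Multiset (Transition n L)).map (fun t => t.2.2) =
      b ::ₘ (w : Multiset (Transition n L)).map (fun t => t.1) := by
  induction w generalizing a with
  | nil => cases h; rfl
  | cons t w ih =>
    have := ih h.2.2
    rw [← Multiset.cons_coe, Multiset.map_cons, Multiset.map_cons, this, h.2.1,
      Multiset.cons_swap]

/-- A multiset of transitions with unit excess at `a` and unit deficit at `b` contains a walk
from `a` to `b`. -/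
theorem exists_walk_le (V : VASS n L) (M : Multiset (Transition n L)) (a b : L)
    (hM : ∀ t ∈ M, t ∈ V.Trns)
    (h : a ::ₘ M.map (fun t => t.2.2) = b ::ₘ M.map (fun t => t.1)) :
    ∃ w, Walk V a w b ∧ (w : Multiset (Transition n L)) ≤ M := by
  induction hk : Multiset.card M generalizing M a with
  | zero =>
    obtain rfl := Multiset.card_eq_zero.1 hk
    refine ⟨[], ?_, le_rfl⟩
    simpa [Walk] using h
  | succ k ih =>
    by_cases hab : a = b
    · exact ⟨[], hab, Multiset.zero_le M⟩
    have ha : a ∈ M.map (fun t => t.1) := by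
      have : a ∈ b ::ₘ M.map (fun t => t.1) := h ▸ Multiset.mem_cons_self _ _
      exact (Multiset.mem_cons.1 this).resolve_left hab
    obtain ⟨t, ht, rfl⟩ := Multiset.mem_map.1 ha
    obtain ⟨M, rfl⟩ := Multiset.exists_cons_of_mem ht
    rw [Multiset.map_cons, Multiset.map_cons, Multiset.cons_swap b, Multiset.cons_inj_right] at h
    obtain ⟨w, hw, hwM⟩ := ih M t.2.2 (fun s hs => hM s (Multiset.mem_cons_of_mem hs)) h
      (by simpa using hk)
    exact ⟨t :: w, ⟨hM t ht, rfl, hw⟩, by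
      rw [← Multiset.cons_coe]; exact (Multiset.cons_le_cons_iff t).2 hwM⟩

theorem Walk.exists_split {V : VASS n L} {a b l : L} {w : List (Transition n L)}
    (h : Walk V a w b) (hl : l = b ∨ ∃ t ∈ w, t.1 = l) :
    ∃ w₁ w₂, w = w₁ ++ w₂ ∧ Walk V a w₁ l ∧ Walk V l w₂ b := by
  induction w generalizing a with
  | nil =>
    obtain rfl : l = b := by simpa using hl
    exact ⟨[], [], rfl, h, rfl⟩
  | cons t w ih =>
    by_cases hla : t.1 = l
    · exact ⟨[], t :: w, rfl, (h.2.1.symm.trans hla), h.1, hla, h.2.2⟩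
    · obtain ⟨w₁, w₂, rfl, h₁, h₂⟩ := ih h.2.2 (by simpa [hla] using hl)
      exact ⟨t :: w₁, w₂, rfl, ⟨h.1, h.2.1, h₁⟩, h₂⟩

/-- In a connected VASS, there is a closed walk through any finite set of locations. -/
theorem exists_walk_visiting {V : VASS n L} (hV : ConnectedV V) {l₀ : L} (h₀ : l₀ ∈ V.Locs)
    (X : Finset L) (hX : X ⊆ V.Locs) :
    ∃ w, Walk V l₀ w l₀ ∧ ∀ l ∈ X, l = l₀ ∨ ∃ t ∈ w, t.1 = l := by
  classical
  induction X using Finset.induction_on with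
  | empty => exact ⟨[], rfl, by simp⟩
  | insert x X hx ih =>
    obtain ⟨w, hw, hvis⟩ := ih fun l hl => hX (Finset.mem_insert_of_mem hl)
    have hxV := hX (Finset.mem_insert_self x X)
    obtain ⟨p, hp⟩ := (hV l₀ h₀ x hxV).exists_walk
    obtain ⟨q, hq⟩ := (hV x hxV l₀ h₀).exists_walk
    refine ⟨w ++ (p ++ q), hw.append (hp.append hq), fun l hl => ?_⟩
    rcases Finset.mem_insert.1 hl with rfl | hl
    · cases q with
      | nil => exact .inl hq
      | cons t q => exact .inr ⟨t, by simp, hq.2.1⟩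
    · exact (hvis l hl).imp_right fun ⟨t, ht, h⟩ => ⟨t, by simp [ht], h⟩

/-- A balanced multiset of transitions can be spliced into a closed walk visiting all
locations. -/
theorem exists_walk_eq_add [DecidableEq L] (V : VASS n L) (l₀ : L)
    (M : Multiset (Transition n L))
    (hM : ∀ t ∈ M, t ∈ V.Trns) (h : M.map (fun t => t.2.2) = M.map (fun t => t.1))
    (w : List (Transition n L)) (hw : Walk V l₀ w l₀)
    (hvis : ∀ l ∈ V.Locs, l = l₀ ∨ ∃ t ∈ w, t.1 = l) :
    ∃ w', Walk V l₀ w' l₀ ∧ (w' : Multiset (Transition n L)) = w + M := by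
  induction hk : Multiset.card M using Nat.strong_induction_on generalizing M w with
  | _ k ih =>
    rcases M.empty_or_exists_mem with rfl | ⟨t, ht⟩
    · exact ⟨w, hw, by simp⟩
    obtain ⟨M, rfl⟩ := Multiset.exists_cons_of_mem ht
    obtain ⟨p, hp, hpM⟩ := exists_walk_le V M t.2.2 t.1
      (fun s hs => hM s (Multiset.mem_cons_of_mem hs)) (by simpa using h)
    obtain ⟨R, rfl⟩ := Multiset.le_iff_exists_add.1 hpM
    have hcyc : Walk V t.1 (t :: p) t.1 := ⟨hM t ht, rfl, hp⟩
    obtain ⟨w₁, w₂, rfl, h₁, h₂⟩ := hw.exists_split (hvis t.1 (V.valid t (hM t ht)).1)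
    obtain ⟨w', hw', hw'M⟩ := ih (Multiset.card R) (by simp at hk; omega) R
      (fun s hs => hM s (by simp [hs]))
      (by
        have hb := hcyc.cons_map_tgt
        rw [Multiset.cons_inj_right] at hb
        rw [← Multiset.cons_add, Multiset.cons_coe, Multiset.map_add, Multiset.map_add, hb] at h
        exact add_left_cancel h)
      (w₁ ++ ((t :: p) ++ w₂)) (h₁.append (hcyc.append h₂))
      (fun l hl => (hvis l hl).imp_right fun ⟨s, hs, h⟩ => ⟨s, by
        rcases List.mem_append.1 hs with hs | hs <;> simp [hs], h⟩) rfl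
    refine ⟨w', hw', ?_⟩
    rw [hw'M, ← Multiset.coe_add, ← Multiset.coe_add, ← Multiset.coe_add, ← Multiset.cons_coe,
      ← Multiset.cons_add]
    abel

theorem neg_sum_natAbs_le_pathVal (p : List (Transition n L)) (i : Fin n) :
    -(((p.map fun t => (t.2.1 i).natAbs).sum : ℕ) : ℤ) ≤ pathVal p i := by
  induction p with
  | nil => simp [pathVal]
  | cons t p ih =>
    simp only [pathVal, List.map_cons, List.sum_cons, Pi.add_apply] at ih ⊢
    push_cast at ih ⊢
    have := neg_abs_le (t.2.1 i)
    linarith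

/-- A non-empty closed walk with non-negative value can be iterated forever. -/
theorem not_terminating_of_walk {V : VASS n L} {l₀ : L} {w : List (Transition n L)}
    (hw : Walk V l₀ w l₀) (hne : w ≠ []) (hval : ∀ i, 0 ≤ pathVal w i) : ¬ Terminating V := by
  let v₀ : Val n := fun i => (w.map fun t => (t.2.1 i).natAbs).sum
  let Safe : L × Val n → Prop := fun s => ∃ u, Walk V s.1 u l₀ ∧
    (∀ p, p <+: u → ∀ i, 0 ≤ (s.2 i : ℤ) + pathVal p i) ∧
    ∀ i, (v₀ i : ℤ) ≤ s.2 i + pathVal u i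
  have hsafe : ∀ v : Val n, (∀ i, v₀ i ≤ v i) →
      (∀ p, p <+: w → ∀ i, 0 ≤ (v i : ℤ) + pathVal p i) ∧
        ∀ i, (v₀ i : ℤ) ≤ v i + pathVal w i := by
    refine fun v hv => ⟨fun p hp i => ?_, fun i => ?_⟩
    · obtain ⟨q, rfl⟩ := hp
      have h₁ := hv i
      have h₂ := neg_sum_natAbs_le_pathVal p i
      simp only [v₀, List.map_append, List.sum_append] at h₁
      have h₃ := Int.ofNat_le.2 ((Nat.le_add_right _ _).trans h₁)
      linarith
    · have h₁ : (v₀ i : ℤ) ≤ v i := by exact_mod_cast hv i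
      linarith [hval i]
  have hstep : ∀ s, Safe s → ∃ d s', Step V s d s' ∧ Safe s' := by
    have key : ∀ s : L × Val n, ∀ t u, Walk V s.1 (t :: u) l₀ →
        (∀ p, p <+: t :: u → ∀ i, 0 ≤ (s.2 i : ℤ) + pathVal p i) →
        (∀ i, (v₀ i : ℤ) ≤ s.2 i + pathVal (t :: u) i) → ∃ d s', Step V s d s' ∧ Safe s' := by
      intro s t u hu hpre hend
      have hpos : ∀ i, 0 ≤ (s.2 i : ℤ) + t.2.1 i := by
        simpa [pathVal] using hpre [t] (by simp)
      have hcast : ∀ i, (((s.2 i : ℤ) + t.2.1 i).toNat : ℤ) = s.2 i + t.2.1 i :=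
        fun i => Int.toNat_of_nonneg (hpos i)
      refine ⟨t.2.1, (t.2.2, fun i => ((s.2 i : ℤ) + t.2.1 i).toNat), ⟨?_, hcast⟩,
        u, hu.2.2, fun p hp i => ?_, fun i => ?_⟩
      · rw [← hu.2.1]; exact hu.1
      · have := hpre (t :: p) (by simpa using hp) i
        simp only [hcast]
        simpa [pathVal, add_assoc] using this
      · have := hend i
        simp only [hcast]
        simpa [pathVal, add_assoc] using this
    rintro s ⟨u, hu, hpre, hend⟩
    cases u with
    | cons t u => exact key s t u hu hpre hend
    | nil =>
      obtain ⟨t, u, rfl⟩ := List.exists_cons_of_ne_nil hne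
      obtain ⟨h₁, h₂⟩ := hsafe s.2 fun i => by simpa [pathVal] using hend i
      have hs : s.1 = l₀ := hu
      exact key s t u (by rw [hs]; exact hw) h₁ h₂
  choose! d next hnext hsafe_next using hstep
  have hiter : ∀ k, Safe (next^[k] (l₀, v₀)) := fun k => by
    induction k with
    | zero => exact ⟨w, hw, hsafe v₀ fun _ => le_rfl⟩
    | succ k ih => rw [Function.iterate_succ_apply']; exact hsafe_next _ ih
  refine fun h => h ⟨fun k => (next^[k] (l₀, v₀)).1, fun k => (next^[k] (l₀, v₀)).2,
    fun k => d (next^[k] (l₀, v₀)), fun k => ?_⟩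
  have := hnext _ (hiter k)
  rwa [← Function.iterate_succ_apply' next] at this

/-- A circulation: non-negative rational weights on the transitions for which inflow and outflow
agree at each location, expressed by testing against all potentials. -/
def IsCirculation (V : VASS n L) (μ : Transition n L → ℚ) : Prop :=
  (∀ t ∈ V.Trns, 0 ≤ μ t) ∧ ∀ z : L → ℚ, ∑ t ∈ V.Trns, (z t.1 - z t.2.2) * μ t = 0

theorem isCirculation_iff [DecidableEq L] {V : VASS n L} {μ : Transition n L → ℚ} :
    IsCirculation V μ ↔ (∀ t ∈ V.Trns, 0 ≤ μ t) ∧ ∀ l ∈ V.Locs,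
      ∑ t ∈ V.Trns,
        ((if t.1 = l then (1 : ℚ) else 0) - (if t.2.2 = l then 1 else 0)) * μ t = 0 := by
  refine and_congr_right fun _ => ⟨fun h l _ => h fun x => if x = l then 1 else 0, fun h z => ?_⟩
  have hz : ∀ l ∈ V.Locs, z l = ∑ l' ∈ V.Locs, z l' * (if l = l' then 1 else 0) := by
    intro l hl
    simp [hl]
  calc ∑ t ∈ V.Trns, (z t.1 - z t.2.2) * μ t
      = ∑ t ∈ V.Trns, ∑ l ∈ V.Locs,
          z l * (((if t.1 = l then (1 : ℚ) else 0) - (if t.2.2 = l then 1 else 0)) * μ t) := by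
        refine Finset.sum_congr rfl fun t ht => ?_
        rw [hz _ (V.valid t ht).1, hz _ (V.valid t ht).2, ← Finset.sum_sub_distrib,
          Finset.sum_mul]
        exact Finset.sum_congr rfl fun l _ => by ring
    _ = 0 := by
        rw [Finset.sum_comm]
        refine Finset.sum_eq_zero fun l hl => ?_
        rw [← Finset.mul_sum, h l hl, mul_zero]

/-- Finitely many non-negative rationals have a common positive natural multiplier which makes
them natural numbers. -/
theorem exists_nat_multiple {ι : Type*} (s : Finset ι) (μ : ι → ℚ) (h : ∀ i ∈ s, 0 ≤ μ i) :
    ∃ N : ℕ, 0 < N ∧ ∃ c : ι → ℕ, ∀ i ∈ s, (c i : ℚ) = N * μ i := by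
  classical
  refine ⟨∏ i ∈ s, (μ i).den, Finset.prod_pos fun i _ => (μ i).den_pos,
    fun i => (∏ j ∈ s.erase i, (μ j).den) * (μ i).num.toNat, fun i hi => ?_⟩
  have hnum : (((μ i).num.toNat : ℕ) : ℚ) = (μ i).num := by
    exact_mod_cast Int.toNat_of_nonneg (Rat.num_nonneg.2 (h i hi))
  rw [← Finset.prod_erase_mul s _ hi, Nat.cast_mul, Nat.cast_mul, hnum, mul_assoc,
    Rat.den_mul_eq_num]

/-- A connected VASS with a fully supported circulation of non-negative value does not
terminate. -/
theorem not_terminating_of_isCirculation {V : VASS n L} (hV : ConnectedV V)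
    {μ : Transition n L → ℚ} (hμ : IsCirculation V μ) (hpos : ∀ t ∈ V.Trns, 0 < μ t)
    (hval : ∀ i, 0 ≤ ∑ t ∈ V.Trns, (t.2.1 i : ℚ) * μ t) (hne : V.Trns.Nonempty) :
    ¬ Terminating V := by
  classical
  obtain ⟨N, hN, c, hc⟩ := exists_nat_multiple V.Trns μ hμ.1
  have hcpos : ∀ t ∈ V.Trns, 1 ≤ c t := fun t ht => by
    have : (0 : ℚ) < c t := by
      rw [hc t ht]; exact mul_pos (by exact_mod_cast hN) (hpos t ht)
    exact_mod_cast this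
  set M : Multiset (Transition n L) := ∑ t ∈ V.Trns, c t • {t} with hM
  have hmap : ∀ {β : Type} (f : Transition n L → β), M.map f = ∑ t ∈ V.Trns, c t • {f t} := by
    intro β f
    rw [← Multiset.coe_mapAddMonoidHom, hM, map_sum]
    simp [map_nsmul]
  have hcount : ∀ t, M.count t = if t ∈ V.Trns then c t else 0 := by
    intro t
    simp [hM, Multiset.count_sum', Multiset.count_nsmul, Multiset.count_singleton]
  have hbal : M.map (fun t => t.2.2) = M.map (fun t => t.1) := by
    rw [hmap, hmap]
    ext l
    simp only [Multiset.count_sum', Multiset.count_nsmul, Multiset.count_singleton]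
    have h := hμ.2 fun x => if l = x then 1 else 0
    have h' : ∑ t ∈ V.Trns, ((if l = t.1 then (1 : ℚ) else 0) - (if l = t.2.2 then 1 else 0)) *
        (c t : ℚ) = 0 := by
      rw [Finset.sum_congr rfl fun t ht => by rw [hc t ht, mul_left_comm], ← Finset.mul_sum, h,
        mul_zero]
    simp only [sub_mul, Finset.sum_sub_distrib, sub_eq_zero] at h'
    simp only [mul_comm (c _)]
    exact_mod_cast h'.symm
  obtain ⟨t₀, ht₀⟩ := hne
  obtain ⟨w, hw, hvis⟩ := exists_walk_visiting hV (V.valid t₀ ht₀).1 V.Locs subset_rfl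
  have hle : (w : Multiset (Transition n L)) ≤ (w.length + 1) • M := by
    refine Multiset.le_iff_count.2 fun t => ?_
    rw [Multiset.count_nsmul, hcount]
    split_ifs with ht
    · calc _ ≤ w.length := Multiset.count_le_card t w
        _ ≤ (w.length + 1) * 1 := by omega
        _ ≤ _ := Nat.mul_le_mul_left _ (hcpos t ht)
    · rw [Multiset.count_eq_zero.2 fun h => ht (hw.mem_trns t h)]
      exact Nat.zero_le _
  obtain ⟨R, hR⟩ := Multiset.le_iff_exists_add.1 hle
  obtain ⟨w', hw', hw'M⟩ := exists_walk_eq_add V t₀.1 R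
    (fun t ht => by
      by_contra hV
      have h₁ : 0 < ((w.length + 1) • M).count t :=
        Multiset.count_pos.2 (hR ▸ Multiset.mem_add.2 (.inr ht))
      rw [Multiset.count_nsmul, hcount, if_neg hV] at h₁
      omega)
    (by
      have h₁ := congrArg (Multiset.map fun t => t.2.2) hR
      have h₂ := congrArg (Multiset.map fun t => t.1) hR
      have hb := hw.cons_map_tgt
      rw [Multiset.cons_inj_right] at hb
      rw [Multiset.map_nsmul, Multiset.map_add] at h₁ h₂
      rw [hbal, h₂, hb] at h₁
      exact (add_left_cancel h₁).symm)
    w hw hvis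
  rw [← hR] at hw'M
  refine not_terminating_of_walk hw' ?_ fun i => ?_
  · rintro rfl
    have := congrArg (Multiset.count t₀) hw'M
    rw [Multiset.count_nsmul, hcount, if_pos ht₀] at this
    have h₁ := hcpos t₀ ht₀
    simp at this
    omega
  · have hsum : pathVal w' = (w.length + 1) • ∑ t ∈ V.Trns, c t • t.2.1 := by
      calc pathVal w' = ((w' : Multiset (Transition n L)).map fun t => t.2.1).sum := by
            simp [pathVal]
        _ = _ := by
            rw [hw'M, Multiset.map_nsmul, Multiset.sum_nsmul, hmap, Multiset.sum_sum]
            simp [Multiset.sum_nsmul]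
    have h₁ : (0 : ℚ) ≤ ∑ t ∈ V.Trns, (c t : ℚ) * (t.2.1 i : ℚ) := by
      rw [Finset.sum_congr rfl fun t ht => by
        rw [hc t ht, mul_assoc, mul_comm (μ t)], ← Finset.mul_sum]
      exact mul_nonneg (by positivity) (hval i)
    have h₂ : (0 : ℤ) ≤ ∑ t ∈ V.Trns, (c t : ℤ) * t.2.1 i := by exact_mod_cast h₁
    rw [hsum]
    simp only [Pi.smul_apply, Finset.sum_apply, nsmul_eq_mul]
    positivity

theorem mem_coneSet_iff [DecidableEq L] {V : VASS n L} {y : Fin n → ℚ} :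
    y ∈ coneSet V ↔ ∃ μ, IsCirculation V μ ∧ y = fun i => ∑ t ∈ V.Trns, (t.2.1 i : ℚ) * μ t := by
  simp only [isCirculation_iff, and_assoc]
  rfl

/-- The change along the transition `t` of the affine function on states with coefficients
`x.1` and offsets `x.2`. -/
def weight (t : Transition n L) : (Fin n → ℚ) × (L → ℚ) →ₗ[ℚ] ℚ where
  toFun x := ∑ i, (t.2.1 i : ℚ) * x.1 i + (x.2 t.2.2 - x.2 t.1)
  map_add' x y := by
    simp only [Prod.fst_add, Prod.snd_add, Pi.add_apply, mul_add, Finset.sum_add_distrib]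
    ring
  map_smul' c x := by
    simp only [Prod.smul_fst, Prod.smul_snd, Pi.smul_apply, smul_eq_mul, RingHom.id_apply,
      mul_add, mul_sub, Finset.mul_sum]
    congr 1
    exact Finset.sum_congr rfl fun i _ => by ring

theorem weight_apply (t : Transition n L) (x : (Fin n → ℚ) × (L → ℚ)) :
    weight t x = ∑ i, (t.2.1 i : ℚ) * x.1 i + (x.2 t.2.2 - x.2 t.1) := rfl

theorem IsCirculation.sum_weight {V : VASS n L} {μ : Transition n L → ℚ}
    (hμ : IsCirculation V μ) (x : (Fin n → ℚ) × (L → ℚ)) :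
    ∑ t ∈ V.Trns, μ t * weight t x = ∑ i, x.1 i * ∑ t ∈ V.Trns, (t.2.1 i : ℚ) * μ t := by
  have h : ∑ t ∈ V.Trns, μ t * (x.2 t.2.2 - x.2 t.1) = 0 := by
    rw [← neg_eq_zero, ← Finset.sum_neg_distrib, ← hμ.2 x.2]
    exact Finset.sum_congr rfl fun t _ => by ring
  simp only [weight_apply, mul_add, Finset.sum_add_distrib, h, add_zero, Finset.mul_sum]
  rw [Finset.sum_comm]
  exact Finset.sum_congr rfl fun i _ => Finset.sum_congr rfl fun t _ => by ring

/-- A transition is recurrent if it carries positive weight in some circulation of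
non-negative value. -/
def Recurrent (V : VASS n L) (t : Transition n L) : Prop :=
  ∃ μ, IsCirculation V μ ∧ (∀ i, 0 ≤ ∑ s ∈ V.Trns, (s.2.1 i : ℚ) * μ s) ∧ 0 < μ t

/-- By Farkas' lemma, a non-recurrent transition is strictly ranked by some affine function
which is weakly decreasing along all transitions. -/
theorem exists_weight_neg_of_not_recurrent [DecidableEq L] {V : VASS n L} {t₀ : Transition n L}
    (ht₀ : t₀ ∈ V.Trns) (h : ¬ Recurrent V t₀) :
    ∃ x : (Fin n → ℚ) × (L → ℚ), (∀ i, 0 ≤ x.1 i) ∧ (∀ t ∈ V.Trns, weight t x ≤ 0) ∧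
      weight t₀ x < 0 := by
  by_contra hcon
  push Not at hcon
  let a : Transition n L ⊕ Fin n → (Fin n → ℚ) × (L → ℚ) →ₗ[ℚ] ℚ :=
    Sum.elim (fun t => -weight t) fun i => LinearMap.proj i ∘ₗ LinearMap.fst ℚ _ _
  obtain ⟨ν, hν, heq⟩ := farkas (V.Trns.disjSum Finset.univ) a (weight t₀) fun x hx => by
    refine hcon x (fun i => ?_) fun t ht => ?_
    · exact hx (.inr i) (by simp)
    · simpa [a] using hx (.inl t) (by simpa using ht)
  have hνt : ∀ t ∈ V.Trns, 0 ≤ ν (.inl t) := fun t ht => hν _ (by simpa using ht)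
  have hνi : ∀ i, 0 ≤ ν (.inr i) := fun i => hν _ (by simp)
  let μ : Transition n L → ℚ := fun t => ν (.inl t) + if t = t₀ then 1 else 0
  have hsum : ∀ x, ∑ t ∈ V.Trns, μ t * weight t x = ∑ i, ν (.inr i) * x.1 i := by
    intro x
    have := congrArg (fun φ => φ x) heq
    simp only [Finset.sum_disjSum, a, Sum.elim_inl, Sum.elim_inr, LinearMap.add_apply,
      LinearMap.sum_apply, LinearMap.smul_apply, LinearMap.neg_apply, smul_eq_mul, mul_neg,
      Finset.sum_neg_distrib, LinearMap.comp_apply, LinearMap.fst_apply,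
      LinearMap.proj_apply] at this
    simp only [μ, add_mul, ite_mul, one_mul, zero_mul, Finset.sum_add_distrib,
      Finset.sum_ite_eq', if_pos ht₀]
    linarith
  refine h ⟨μ, ⟨fun t ht => add_nonneg (hνt t ht) (by split_ifs <;> simp), fun z => ?_⟩,
    fun i => ?_, ?_⟩
  · have := hsum (0, -z)
    simp only [weight_apply, Pi.zero_apply, mul_zero, Finset.sum_const_zero, zero_add,
      Pi.neg_apply] at this
    rw [← this]
    exact Finset.sum_congr rfl fun t _ => by ring
  · have := hsum (Pi.single i 1, 0)
    simp only [weight_apply, Pi.zero_apply, Pi.single_apply, mul_ite, mul_one, mul_zero, sub_self,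
      add_zero, Finset.sum_ite_eq', Finset.mem_univ, if_true] at this
    simp only [mul_comm _ (μ _), this]
    exact hνi i
  · have := hνt t₀ ht₀
    simp only [μ, if_true]
    linarith

/-- An affine function which is constant along recurrent transitions and strictly decreasing
along all others. -/
theorem exists_weight_neg_of_forall_not_recurrent [DecidableEq L] (V : VASS n L) :
    ∃ x : (Fin n → ℚ) × (L → ℚ), (∀ i, 0 ≤ x.1 i) ∧
      (∀ t ∈ V.Trns, Recurrent V t → weight t x = 0) ∧
      ∀ t ∈ V.Trns, ¬ Recurrent V t → weight t x < 0 := by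
  classical
  have h : ∀ t, ∃ x : (Fin n → ℚ) × (L → ℚ), (∀ i, 0 ≤ x.1 i) ∧
      (∀ s ∈ V.Trns, weight s x ≤ 0) ∧ (t ∈ V.Trns → ¬ Recurrent V t → weight t x < 0) := by
    intro t
    by_cases ht : t ∈ V.Trns ∧ ¬ Recurrent V t
    · obtain ⟨x, h₁, h₂, h₃⟩ := exists_weight_neg_of_not_recurrent ht.1 ht.2
      exact ⟨x, h₁, h₂, fun _ _ => h₃⟩
    · exact ⟨0, by simp, by simp, fun h₁ h₂ => absurd ⟨h₁, h₂⟩ ht⟩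
  choose x hx₁ hx₂ hx₃ using h
  have hpos : ∀ i, 0 ≤ (∑ t ∈ V.Trns, x t).1 i := fun i => by
    rw [Prod.fst_sum, Finset.sum_apply]
    exact Finset.sum_nonneg fun t _ => hx₁ t i
  have hle : ∀ t ∈ V.Trns, weight t (∑ s ∈ V.Trns, x s) ≤ 0 := fun t ht => by
    rw [map_sum]
    exact Finset.sum_nonpos fun s _ => hx₂ s t ht
  refine ⟨∑ t ∈ V.Trns, x t, hpos, fun t ht hrec => ?_, fun t ht hrec => ?_⟩
  · obtain ⟨μ, hμ, hval, hμt⟩ := hrec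
    have hnonpos : ∀ s ∈ V.Trns, μ s * weight s (∑ s ∈ V.Trns, x s) ≤ 0 := fun s hs =>
      mul_nonpos_of_nonneg_of_nonpos (hμ.1 s hs) (hle s hs)
    have hzero : ∑ s ∈ V.Trns, μ s * weight s (∑ s ∈ V.Trns, x s) = 0 := by
      refine le_antisymm (Finset.sum_nonpos hnonpos) ?_
      rw [hμ.sum_weight]
      exact Finset.sum_nonneg fun i _ => mul_nonneg (hpos i) (hval i)
    exact (mul_eq_zero.1 ((Finset.sum_eq_zero_iff_of_nonpos hnonpos).1 hzero t ht)).resolve_left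
      hμt.ne'
  · rw [map_sum]
    exact Finset.sum_neg' (fun s _ => hx₂ s t ht) ⟨t, ht, hx₃ t ht hrec⟩

/-- An affine function with non-negative coefficients can be rescaled to take values in `ℕ`. -/
theorem exists_nat_ranking (V : VASS n L) (x : (Fin n → ℚ) × (L → ℚ)) (hx : ∀ i, 0 ≤ x.1 i) :
    ∃ q : L × Val n → ℕ, ∀ s d s', Step V s d s' →
      (weight (s.1, d, s'.1) x = 0 → q s' = q s) ∧
      (weight (s.1, d, s'.1) x < 0 → q s' < q s) := by
  classical
  obtain ⟨C, hC⟩ := (V.Locs.image fun l => -x.2 l).exists_le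
  obtain ⟨M, hM⟩ := (insert 0 (V.Trns.image fun t => (-weight t x)⁻¹)).exists_le
  have hC' : ∀ l ∈ V.Locs, 0 ≤ x.2 l + C := fun l hl => by
    linarith [hC _ (Finset.mem_image_of_mem _ hl)]
  have hM₀ : 0 ≤ M := hM 0 (Finset.mem_insert_self _ _)
  let p : L × Val n → ℚ := fun s => M * (∑ i, (s.2 i : ℚ) * x.1 i + (x.2 s.1 + C))
  have hp : ∀ s d s', Step V s d s' → p s' = p s + M * weight (s.1, d, s'.1) x := by
    intro s d s' h
    have hv : ∀ i, (s'.2 i : ℚ) = s.2 i + d i := fun i => by exact_mod_cast h.2 i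
    simp only [p, weight_apply, hv, add_mul, Finset.sum_add_distrib]
    ring
  refine ⟨fun s => ⌊p s⌋₊, fun s d s' h => ⟨fun hw => ?_, fun hw => ?_⟩⟩
  · simp only [hp s d s' h, hw, mul_zero, add_zero]
  · have hs' : 0 ≤ p s' := mul_nonneg hM₀ (add_nonneg
      (Finset.sum_nonneg fun i _ => mul_nonneg (Nat.cast_nonneg _) (hx i))
      (hC' _ (V.valid _ h.1).2))
    have hM' := hM _ (Finset.mem_insert_of_mem (Finset.mem_image_of_mem _ h.1))
    have hge : 1 ≤ M * -weight (s.1, d, s'.1) x := by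
      calc (1 : ℚ) = (-weight (s.1, d, s'.1) x)⁻¹ * -weight (s.1, d, s'.1) x :=
            (inv_mul_cancel₀ (by linarith)).symm
        _ ≤ _ := mul_le_mul_of_nonneg_right hM' (by linarith)
    have := hp s d s' h
    rw [← Nat.add_one_le_iff, ← Nat.floor_add_one hs']
    exact Nat.floor_le_floor (by linarith)

open Classical in
/-- The sub-VASS of the recurrent transitions. -/
noncomputable def recurrentPart (V : VASS n L) : VASS n L where
  Locs := V.Locs
  Trns := V.Trns.filter (Recurrent V)
  valid t ht := V.valid t (Finset.mem_filter.1 ht).1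

theorem mem_recurrentPart_trns {V : VASS n L} {t : Transition n L} :
    t ∈ (recurrentPart V).Trns ↔ t ∈ V.Trns ∧ Recurrent V t := by
  classical exact Finset.mem_filter

open Classical in
/-- The sub-VASS of the locations reachable from `l`. -/
noncomputable def reachablePart (V : VASS n L) (l : L) : VASS n L where
  Locs := V.Locs.filter (Reaches V l)
  Trns := V.Trns.filter fun t => Reaches V l t.1
  valid t ht := by
    obtain ⟨ht, hl⟩ := Finset.mem_filter.1 ht
    exact ⟨Finset.mem_filter.2 ⟨(V.valid t ht).1, hl⟩,
      Finset.mem_filter.2 ⟨(V.valid t ht).2, hl.tail ⟨t.2.1, ht⟩⟩⟩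

theorem mem_reachablePart_locs {V : VASS n L} {l m : L} :
    m ∈ (reachablePart V l).Locs ↔ m ∈ V.Locs ∧ Reaches V l m := by
  classical exact Finset.mem_filter

theorem mem_reachablePart_trns {V : VASS n L} {l : L} {t : Transition n L} :
    t ∈ (reachablePart V l).Trns ↔ t ∈ V.Trns ∧ Reaches V l t.1 := by
  classical exact Finset.mem_filter

/-- Recurrent transitions can be undone by walks of recurrent transitions. -/
theorem reaches_recurrentPart_symm_of_mem {V : VASS n L} {t : Transition n L}
    (ht : t ∈ (recurrentPart V).Trns) : Reaches (recurrentPart V) t.2.2 t.1 := by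
  classical
  obtain ⟨htV, μ, hμ, hval, hμt⟩ := mem_recurrentPart_trns.1 ht
  by_contra hcon
  have hterm : ∀ s ∈ V.Trns,
      ((if Reaches (recurrentPart V) t.2.2 s.1 then (1 : ℚ) else 0) -
        (if Reaches (recurrentPart V) t.2.2 s.2.2 then 1 else 0)) * μ s ≤ 0 := by
    intro s hs
    rcases (hμ.1 s hs).eq_or_lt with h₀ | h₀
    · rw [← h₀, mul_zero]
    · refine mul_nonpos_of_nonpos_of_nonneg ?_ h₀.le
      have hs' : s ∈ (recurrentPart V).Trns := mem_recurrentPart_trns.2 ⟨hs, μ, hμ, hval, h₀⟩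
      by_cases h : Reaches (recurrentPart V) t.2.2 s.1
      · rw [if_pos h, if_pos (show Reaches _ _ _ from h.tail ⟨s.2.1, hs'⟩), sub_self]
      · rw [if_neg h]
        split_ifs <;> simp
  have := (Finset.sum_eq_zero_iff_of_nonpos hterm).1
    (hμ.2 fun l => if Reaches (recurrentPart V) t.2.2 l then 1 else 0) t htV
  rw [if_neg hcon, if_pos (show Reaches _ _ _ from .refl)] at this
  linarith

theorem reaches_recurrentPart_symm {V : VASS n L} {a b : L}
    (h : Reaches (recurrentPart V) a b) : Reaches (recurrentPart V) b a := by
  induction h with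
  | refl => exact .refl
  | tail _ h ih =>
    obtain ⟨d, hd⟩ := h
    exact (reaches_recurrentPart_symm_of_mem hd).trans ih

theorem reaches_reachablePart {V : VASS n L} {l a b : L} (ha : Reaches V l a)
    (h : Reaches V a b) : Reaches (reachablePart V l) a b := by
  induction h with
  | refl => exact .refl
  | tail hab h ih =>
    obtain ⟨d, hd⟩ := h
    exact ih.tail ⟨d, mem_reachablePart_trns.2 ⟨hd, ha.trans hab⟩⟩

theorem connectedV_reachablePart_recurrentPart (V : VASS n L) (l : L) :
    ConnectedV (reachablePart (recurrentPart V) l) := by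
  intro a ha b hb
  replace ha := (mem_reachablePart_locs.1 ha).2
  replace hb := (mem_reachablePart_locs.1 hb).2
  exact reaches_reachablePart ha ((reaches_recurrentPart_symm ha).trans hb)

theorem reachablePart_recurrentPart_eq {V : VASS n L} {t : Transition n L}
    (ht : t ∈ (recurrentPart V).Trns) :
    reachablePart (recurrentPart V) t.1 = reachablePart (recurrentPart V) t.2.2 := by
  have h : ∀ m, Reaches (recurrentPart V) t.1 m ↔ Reaches (recurrentPart V) t.2.2 m := fun m =>
    ⟨(reaches_recurrentPart_symm_of_mem ht).trans, .head ⟨t.2.1, ht⟩⟩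
  have hext : ∀ {S S' : VASS n L}, S.Locs = S'.Locs → S.Trns = S'.Trns → S = S' := by
    rintro ⟨⟩ ⟨⟩ rfl rfl
    rfl
  exact hext (Finset.ext fun m => by simp only [mem_reachablePart_locs, h])
    (Finset.ext fun s => by simp only [mem_reachablePart_trns, h])

theorem Terminating.of_subset {S V : VASS n L} (hV : Terminating V) (h : S.Trns ⊆ V.Trns) :
    Terminating S :=
  fun ⟨ℓ, v, d, hS⟩ => hV ⟨ℓ, v, d, fun i => ⟨h (hS i).1, (hS i).2⟩⟩

theorem coneSet_subset [DecidableEq L] {S V : VASS n L} (h : S.Trns ⊆ V.Trns) :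
    coneSet S ⊆ coneSet V := by
  intro y hy
  obtain ⟨μ, hμ, rfl⟩ := mem_coneSet_iff.1 hy
  have hsum : ∀ g : Transition n L → ℚ,
      ∑ t ∈ V.Trns, g t * (if t ∈ S.Trns then μ t else 0) = ∑ t ∈ S.Trns, g t * μ t := fun g => by
    rw [← Finset.sum_subset h fun t _ ht => by rw [if_neg ht, mul_zero]]
    exact Finset.sum_congr rfl fun t ht => by rw [if_pos ht]
  refine mem_coneSet_iff.2 ⟨fun t => if t ∈ S.Trns then μ t else 0, ⟨fun t _ => ?_, fun z => ?_⟩,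
    funext fun i => (hsum _).symm⟩
  · dsimp only
    split_ifs with ht
    exacts [hμ.1 t ht, le_rfl]
  · rw [hsum]
    exact hμ.2 z

theorem Reaches.exists_flow [DecidableEq L] {V : VASS n L} {a b : L} (h : Reaches V a b) :
    ∃ μ : Transition n L → ℚ, (∀ t, 0 ≤ μ t) ∧
      ∀ z : L → ℚ, ∑ t ∈ V.Trns, (z t.1 - z t.2.2) * μ t = z a - z b := by
  induction h with
  | refl => exact ⟨0, by simp, by simp⟩
  | @tail b c _ h ih =>
    obtain ⟨d, hd⟩ := h
    obtain ⟨μ, hμ, hz⟩ := ih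
    refine ⟨fun t => μ t + if t = (b, d, c) then 1 else 0,
      fun t => add_nonneg (hμ t) (by split_ifs <;> simp), fun z => ?_⟩
    simp only [mul_add, Finset.sum_add_distrib, hz, mul_ite, mul_one, mul_zero,
      Finset.sum_ite_eq', if_pos hd]
    ring

/-- In a connected VASS, every transition carries positive weight in some circulation. -/
theorem exists_isCirculation_pos [DecidableEq L] {V : VASS n L} (hV : ConnectedV V)
    {t : Transition n L} (ht : t ∈ V.Trns) : ∃ μ, IsCirculation V μ ∧ 0 < μ t := by
  obtain ⟨μ, hμ, hz⟩ := (hV _ (V.valid t ht).2 _ (V.valid t ht).1).exists_flow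
  refine ⟨fun s => μ s + if s = t then 1 else 0,
    ⟨fun s _ => add_nonneg (hμ s) (by split_ifs <;> simp), fun z => ?_⟩, ?_⟩
  · simp only [mul_add, Finset.sum_add_distrib, hz, mul_ite, mul_one, mul_zero,
      Finset.sum_ite_eq', if_pos ht]
    ring
  · have := hμ t
    simp only [if_true]
    linarith

theorem exists_not_recurrent [DecidableEq L] {V : VASS n L} (hV : ConnectedV V)
    (hterm : Terminating V) (hne : V.Trns.Nonempty) : ∃ t ∈ V.Trns, ¬ Recurrent V t := by
  by_contra! hcon
  choose! μ hμ hval hpos using hcon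
  refine not_terminating_of_isCirculation (μ := ∑ s ∈ V.Trns, μ s) hV
    ⟨fun t ht => ?_, fun z => ?_⟩ (fun t ht => ?_) (fun i => ?_) hne hterm
  · rw [Finset.sum_apply]
    exact Finset.sum_nonneg fun s hs => (hμ s hs).1 t ht
  · simp only [Finset.sum_apply, Finset.mul_sum]
    rw [Finset.sum_comm]
    exact Finset.sum_eq_zero fun s hs => (hμ s hs).2 z
  · rw [Finset.sum_apply]
    exact Finset.sum_pos' (fun s hs => (hμ s hs).1 t ht) ⟨t, ht, hpos t ht⟩
  · simp only [Finset.sum_apply, Finset.mul_sum]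
    rw [Finset.sum_comm]
    exact Finset.sum_nonneg fun s hs => hval s hs i

/-- If an affine function is weakly decreasing along the transitions of the connected VASS `V`,
strictly along one of them, and constant along the transitions of `S`, then the cone of `S` has
smaller dimension. -/
theorem coneDim_lt [DecidableEq L] {S V : VASS n L} (hV : ConnectedV V)
    (hSV : S.Trns ⊆ V.Trns) (x : (Fin n → ℚ) × (L → ℚ)) (hle : ∀ t ∈ V.Trns, weight t x ≤ 0)
    (hS : ∀ t ∈ S.Trns, weight t x = 0) {t₀ : Transition n L} (ht₀ : t₀ ∈ V.Trns)
    (hlt : weight t₀ x < 0) : coneDim S < coneDim V := by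
  refine Submodule.finrank_lt_finrank_of_lt (lt_of_le_not_ge
    (Submodule.span_mono (coneSet_subset hSV)) fun hge => ?_)
  let φ : (Fin n → ℚ) →ₗ[ℚ] ℚ := ∑ i, x.1 i • LinearMap.proj i
  have hφ : ∀ y, φ y = ∑ i, x.1 i * y i := fun y => by simp [φ]
  have hker : Submodule.span ℚ (coneSet S) ≤ LinearMap.ker φ := by
    refine Submodule.span_le.2 fun y hy => ?_
    obtain ⟨μ, hμ, rfl⟩ := mem_coneSet_iff.1 hy
    rw [SetLike.mem_coe, LinearMap.mem_ker, hφ, ← hμ.sum_weight]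
    exact Finset.sum_eq_zero fun t ht => by rw [hS t ht, mul_zero]
  obtain ⟨μ, hμ, hpos⟩ := exists_isCirculation_pos hV ht₀
  have hzero := hker (hge (Submodule.subset_span (mem_coneSet_iff.2 ⟨μ, hμ, rfl⟩)))
  rw [LinearMap.mem_ker, hφ, ← hμ.sum_weight] at hzero
  refine hzero.not_lt (Finset.sum_neg' (fun t ht => ?_) ⟨t₀, ht₀, ?_⟩)
  · exact mul_nonpos_of_nonneg_of_nonpos (hμ.1 t ht) (hle t ht)
  · exact mul_neg_of_pos_of_neg hpos hlt

theorem LexGt.cons_of_lt {a b : ℕ} {x y : List ℕ} (h : b < a) : LexGt (a :: x) (b :: y) :=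
  ⟨0, by simp, by simp, by simpa using h, by simp⟩

theorem LexGt.cons {a : ℕ} {x y : List ℕ} (h : LexGt x y) : LexGt (a :: x) (a :: y) := by
  obtain ⟨i, hx, hy, hlt, heq⟩ := h
  refine ⟨i + 1, by simpa using hx, by simpa using hy, by simpa using hlt, fun j hj => ?_⟩
  cases j with
  | zero => simp
  | succ j => simpa using heq j (by omega)

theorem exists_isLexRankingOfOrder_coneDim [DecidableEq L] (V : VASS n L) (hV : ConnectedV V)
    (hterm : Terminating V) : ∃ f, IsLexRankingOfOrder V (coneDim V) f := by
  induction hk : coneDim V using Nat.strong_induction_on generalizing V with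
  | _ k ih =>
    subst hk
    rcases V.Trns.eq_empty_or_nonempty with hempty | hne
    · refine ⟨fun _ => [], by simp, fun s d s' h => ?_⟩
      have := h.1
      simp [hempty] at this
    obtain ⟨t₀, ht₀, hrec₀⟩ := exists_not_recurrent hV hterm hne
    obtain ⟨x, hx, hzero, hneg⟩ := exists_weight_neg_of_forall_not_recurrent V
    obtain ⟨q, hq⟩ := exists_nat_ranking V x hx
    have hle : ∀ t ∈ V.Trns, weight t x ≤ 0 := fun t ht => by
      by_cases h : Recurrent V t
      exacts [(hzero t ht h).le, (hneg t ht h).le]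
    have hsub : ∀ l, (reachablePart (recurrentPart V) l).Trns ⊆ V.Trns := fun l t ht =>
      (mem_recurrentPart_trns.1 (mem_reachablePart_trns.1 ht).1).1
    have hdim : ∀ l, coneDim (reachablePart (recurrentPart V) l) < coneDim V := fun l =>
      coneDim_lt hV (hsub l) x hle
        (fun t ht => hzero t (hsub l ht)
          (mem_recurrentPart_trns.1 (mem_reachablePart_trns.1 ht).1).2) ht₀ (hneg t₀ ht₀ hrec₀)
    have hex : ∀ S : VASS n L, coneDim S < coneDim V → ConnectedV S → Terminating S →
        ∃ f, IsLexRankingOfOrder S (coneDim S) f := fun S h h₁ h₂ => ih _ h S h₁ h₂ rfl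
    choose! g hg using hex
    have hg' := fun l => hg _ (hdim l) (connectedV_reachablePart_recurrentPart V l)
      (hterm.of_subset (hsub l))
    refine ⟨fun s => q s :: g (reachablePart (recurrentPart V) s.1) s, fun s hs => ?_,
      fun s d s' h => ?_⟩
    · have := (hg' s.1).1 s (mem_reachablePart_locs.2 ⟨hs, .refl⟩)
      have := hdim s.1
      rw [List.length_cons]
      omega
    · by_cases hrec : Recurrent V (s.1, d, s'.1)
      · have ht := mem_recurrentPart_trns.2 ⟨h.1, hrec⟩
        simp only [(hq s d s' h).1 (hzero _ h.1 hrec), ← reachablePart_recurrentPart_eq ht]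
        exact ((hg' s.1).2 s d s' ⟨mem_reachablePart_trns.2 ⟨ht, .refl⟩, h.2⟩).cons
      · exact .cons_of_lt ((hq s d s' h).2 (hneg _ h.1 hrec))

theorem coneDim_le [DecidableEq L] (V : VASS n L) : coneDim V ≤ n := by
  simpa [coneDim] using Submodule.finrank_le (Submodule.span ℚ (coneSet V))

/-- **Existence of lexicographic ranking functions for terminating VASSs.** Every
connected terminating VASS admits a lexicographic ranking function of order at most
`dim(cone(V))`, which is at most `n`. -/
theorem terminating_has_lex_ranking {n : ℕ} {L : Type} [DecidableEq L]
    (V : VASS n L) (hconn : ConnectedV V) (hterm : Terminating V) :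
    (∃ f, IsLexRankingOfOrder V (coneDim V) f) ∧ coneDim V ≤ n := by
  exact ⟨exists_isLexRankingOfOrder_coneDim V hconn hterm, coneDim_le V⟩

end VASSPaper
end

section
/- Termination dichotomy for VASSs: A VASS V is non-terminating (has an infinite trace) if and only if V has a non-negative cycle. -/
namespace VASSPaper

variable {n : ℕ} {L : Type}

/-- Along an infinite trace, some location recurs with a componentwise larger or equal valuation. -/
theorem InfTrace.exists_le {V : VASS n L} {ℓ : ℕ → L} {v : ℕ → Val n} {d : ℕ → Upd n}
    (h : InfTrace V ℓ v d) : ∃ i j, i < j ∧ ℓ i = ℓ j ∧ v i ≤ v j := by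
  let loc : ℕ → V.Locs := fun i => ⟨ℓ i, (V.valid _ (h i).1).1⟩
  have hwqo : WellQuasiOrdered (fun a b : V.Locs × Val n => a.1 = b.1 ∧ a.2 ≤ b.2) :=
    (Finite.wellQuasiOrdered (· = ·)).prod wellQuasiOrdered_le
  obtain ⟨i, j, hij, hloc, hv⟩ := hwqo fun i => (loc i, v i)
  exact ⟨i, j, hij, congrArg Subtype.val hloc, hv⟩

/-- Between two visits of the same location, a trace follows a cycle whose value is the change
of the valuation. -/
theorem InfTrace.exists_isCycle {V : VASS n L} {ℓ : ℕ → L} {v : ℕ → Val n} {d : ℕ → Upd n}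
    (h : InfTrace V ℓ v d) {i j : ℕ} (hij : i < j) (hl : ℓ i = ℓ j) :
    ∃ π, IsCycle V π ∧ ∀ c, pathVal π c = v j c - v i c := by
  obtain ⟨m, rfl⟩ := Nat.exists_eq_add_of_lt hij
  refine ⟨(List.range (m + 1)).map fun r => (ℓ (i + r), d (i + r), ℓ (i + r + 1)),
    ⟨⟨?_, ?_⟩, by simp, ?_⟩, fun c => ?_⟩
  · intro t ht
    obtain ⟨r, -, rfl⟩ := List.mem_map.1 ht
    exact (h (i + r)).1
  · refine List.isChain_map _ |>.2 ?_
    rw [List.isChain_range_succ]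
    exact fun _ _ => rfl
  · simp [List.head?_range, List.getLast?_range, hl]
  · have hsum : ∀ k, pathVal ((List.range k).map fun r => (ℓ (i + r), d (i + r), ℓ (i + r + 1))) c
        = v (i + k) c - v i c := by
      intro k
      induction k with
      | zero => simp [pathVal]
      | succ k ih =>
        have hstep := (h (i + k)).2 c
        simp only [pathVal, List.range_succ, List.map_append, List.sum_append, Pi.add_apply] at ih ⊢
        rw [ih]
        simp only [List.map_cons, List.map_nil, List.sum_cons, List.sum_nil, Pi.add_apply,
          Pi.zero_apply]
        rw [← add_assoc i k 1]
        linarith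
    exact hsum (m + 1)

/-- The partial sums of a periodic integer sequence with non-negative sum over a period are
bounded below. -/
theorem neg_sum_abs_le_sum_range_of_periodic {f : ℕ → ℤ} {m : ℕ} (hm : 0 < m)
    (hf : Function.Periodic f m) (hsum : 0 ≤ ∑ k ∈ Finset.range m, f k) (i : ℕ) :
    -∑ k ∈ Finset.range m, |f k| ≤ ∑ k ∈ Finset.range i, f k := by
  induction i using Nat.strong_induction_on with
  | _ i ih =>
    rcases lt_or_ge i m with him | him
    · calc -∑ k ∈ Finset.range m, |f k| ≤ -∑ k ∈ Finset.range i, |f k| :=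
            neg_le_neg (Finset.sum_le_sum_of_subset_of_nonneg
              (Finset.range_mono him.le) fun _ _ _ => abs_nonneg _)
        _ ≤ ∑ k ∈ Finset.range i, f k :=
            neg_le_of_abs_le (Finset.abs_sum_le_sum_abs _ _)
    · obtain ⟨r, rfl⟩ := Nat.exists_eq_add_of_le him
      have hshift : ∑ k ∈ Finset.range r, f (m + k) = ∑ k ∈ Finset.range r, f k :=
        Finset.sum_congr rfl fun k _ => by rw [add_comm, hf k]
      rw [Finset.sum_range_add, hshift]
      linarith [ih r (by omega)]

/-- Repeating a non-negative cycle forever gives an infinite trace. -/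
theorem IsCycle.exists_infTrace {V : VASS n L} {π : List (Transition n L)} (hπ : IsCycle V π)
    (hval : ∀ c, 0 ≤ pathVal π c) : ∃ ℓ v d, InfTrace V ℓ v d := by
  obtain ⟨⟨hmem, hchain⟩, hne, hends⟩ := hπ
  have hm : 0 < π.length := List.length_pos_iff.2 hne
  let t : ℕ → Transition n L := fun i => π[i % π.length]'(Nat.mod_lt i hm)
  have hlink : ∀ i, (t i).2.2 = (t (i + 1)).1 := by
    intro i
    rcases Nat.lt_or_ge (i % π.length + 1) π.length with hi | hi
    · have hsucc : (i + 1) % π.length = i % π.length + 1 := by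
        rw [Nat.add_mod_eq_ite]
        rw [Nat.mod_eq_of_lt (by omega : 1 < π.length), if_neg (by omega)]
      simp only [t, hsucc]
      exact List.isChain_iff_getElem.1 hchain _ hi
    · have hlast : i % π.length = π.length - 1 := by
        have := Nat.mod_lt i hm
        omega
      have hsucc : (i + 1) % π.length = 0 := by
        rw [← Nat.mod_add_mod, hlast, Nat.sub_add_cancel hm, Nat.mod_self]
      simp only [t, hsucc, hlast]
      rw [List.head?_eq_getElem?, List.getLast?_eq_getElem?, List.getElem?_eq_getElem hm,
        List.getElem?_eq_getElem (by omega)] at hends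
      exact (Option.some.inj hends).symm
  have hper : ∀ c, Function.Periodic (fun k => (t k).2.1 c) π.length := fun c k => by simp [t]
  have hsum : ∀ c, 0 ≤ ∑ k ∈ Finset.range π.length, (t k).2.1 c := by
    intro c
    convert hval c
    rw [pathVal, ← Fin.sum_univ_fun_getElem, Finset.sum_apply, Finset.sum_range]
    exact Finset.sum_congr rfl fun k _ => by simp [t, Nat.mod_eq_of_lt k.2]
  let w : ℕ → Upd n := fun i c =>
    ∑ k ∈ Finset.range π.length, |(t k).2.1 c| + ∑ k ∈ Finset.range i, (t k).2.1 c
  have hw : ∀ i c, 0 ≤ w i c := fun i c => by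
    have := neg_sum_abs_le_sum_range_of_periodic hm (hper c) (hsum c) i
    simp only [w]
    linarith
  refine ⟨fun i => (t i).1, fun i c => (w i c).toNat, fun i => (t i).2.1, fun i => ⟨?_, fun c => ?_⟩⟩
  · rw [← hlink i]
    exact hmem _ (List.getElem_mem _)
  · simp only [Int.toNat_of_nonneg (hw _ c)]
    simp only [w, Finset.sum_range_succ, add_assoc]

/-- **Termination dichotomy.** A VASS is non-terminating (has an infinite trace) iff
it has a non-negative cycle. -/
theorem nontermination_iff_nonneg_cycle {n : ℕ} {L : Type} (V : VASS n L) :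
    (∃ ℓ v d, InfTrace V ℓ v d) ↔ ∃ π, IsCycle V π ∧ ∀ i, 0 ≤ pathVal π i := by
  constructor
  · rintro ⟨ℓ, v, d, h⟩
    obtain ⟨i, j, hij, hl, hv⟩ := h.exists_le
    obtain ⟨π, hπ, hval⟩ := h.exists_isCycle hij hl
    exact ⟨π, hπ, fun c => by rw [hval c]; exact sub_nonneg.2 (Int.ofNat_le.2 (hv c))⟩
  · rintro ⟨π, hπ, hval⟩
    exact hπ.exists_infTrace hval

end VASSPaper
end

section
/- Linear complexity of vector addition systems: Every terminating VASS V with exactly one location (i.e., a vector addition system) has at most linear computational complexity, i.e., comp_N(V) ∈ O(N): there is a constant C such that comp_N(V) ≤ C·N for all N ≥ 1. -/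
namespace VASSPaper

variable {n : ℕ} {L : Type}

/-- Ville's theorem of the alternative: if no sum of a non-empty family of elements of the finite
set `D` is non-negative, then some non-negative linear form is negative on `D`. -/
theorem exists_nonneg_form_neg (n : ℕ) (D : Finset (Fin n → ℤ))
    (hD : ∀ x ∈ AddSubsemigroup.closure (D : Set (Fin n → ℤ)), ¬ 0 ≤ x) :
    ∃ r : Fin n → ℚ, (∀ i, 0 ≤ r i) ∧ ∀ d ∈ D, ∑ i, r i * (d i : ℚ) < 0 := by
  induction n with
  | zero =>
    refine ⟨0, fun i => i.elim0, fun d hd => ?_⟩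
    exact absurd (fun i => i.elim0) (hD d (AddSubsemigroup.subset_closure hd))
  | succ n ih =>
    classical
    -- Fourier–Motzkin elimination of the first coordinate
    let D' : Finset (Fin n → ℤ) := (D.filter (fun d => 0 ≤ d 0)).image Fin.tail ∪
      ((D.filter (fun d => 0 < d 0)) ×ˢ (D.filter (fun d => d 0 < 0))).image
        (fun pq => pq.1 0 • Fin.tail pq.2 + (-pq.2 0) • Fin.tail pq.1)
    have nsmul_mem : ∀ (x : Fin (n + 1) → ℤ) (k : ℤ), 0 < k → x ∈ D →
        k • x ∈ AddSubsemigroup.closure (D : Set (Fin (n + 1) → ℤ)) := by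
      intro x k hk hx
      induction k, (show (1 : ℤ) ≤ k from hk) using Int.leInduction with
      | base => simpa using AddSubsemigroup.subset_closure hx
      | succ k hk' ihk =>
        rw [add_smul, one_smul]
        exact add_mem (ihk (by omega)) (AddSubsemigroup.subset_closure hx)
    have lift : ∀ x ∈ AddSubsemigroup.closure (D' : Set (Fin n → ℤ)),
        ∃ y ∈ AddSubsemigroup.closure (D : Set (Fin (n + 1) → ℤ)),
          0 ≤ y 0 ∧ Fin.tail y = x := by
      intro x hx
      induction hx using AddSubsemigroup.closure_induction with
      | mem x hx =>
        simp only [D', Finset.coe_union, Finset.coe_image, Set.mem_union, Set.mem_image,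
          Finset.mem_coe, Finset.mem_filter, Finset.mem_product] at hx
        rcases hx with ⟨d, ⟨hd, h0⟩, rfl⟩ | ⟨⟨p, q⟩, ⟨⟨hp, hp0⟩, hq, hq0⟩, rfl⟩
        · exact ⟨d, AddSubsemigroup.subset_closure hd, h0, rfl⟩
        · refine ⟨p 0 • q + (-q 0) • p, add_mem (nsmul_mem q _ hp0 hq)
            (nsmul_mem p _ (by simpa using hq0) hp), ?_, rfl⟩
          simp only [Pi.add_apply, Pi.smul_apply, smul_eq_mul]
          exact le_of_eq (by ring)
      | add x y _ _ hx hy =>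
        obtain ⟨x', hx', hx0, rfl⟩ := hx
        obtain ⟨y', hy', hy0, rfl⟩ := hy
        exact ⟨x' + y', add_mem hx' hy', add_nonneg hx0 hy0, rfl⟩
    obtain ⟨r, hr, hrD⟩ := ih D' (by
      intro x hx h0
      obtain ⟨y, hy, hy0, rfl⟩ := lift x hx
      exact hD y hy (fun i => Fin.cases hy0 (fun j => h0 j) i))
    let φ : (Fin (n + 1) → ℤ) → ℚ := fun d => ∑ i, r i * (d i.succ : ℚ)
    have hnonneg : ∀ d ∈ D, 0 ≤ d 0 → φ d < 0 := fun d hd h0 =>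
      hrD (Fin.tail d) (Finset.mem_union_left _
        (Finset.mem_image_of_mem _ (Finset.mem_filter.2 ⟨hd, h0⟩)))
    have hpair : ∀ p ∈ D, ∀ q ∈ D, 0 < p 0 → q 0 < 0 →
        (p 0 : ℚ) * φ q - (q 0 : ℚ) * φ p < 0 := by
      intro p hp q hq hp0 hq0
      have h := hrD (p 0 • Fin.tail q + (-q 0) • Fin.tail p) (Finset.mem_union_right _
        (Finset.mem_image.2 ⟨(p, q), Finset.mem_product.2
          ⟨Finset.mem_filter.2 ⟨hp, hp0⟩, Finset.mem_filter.2 ⟨hq, hq0⟩⟩, rfl⟩))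
      refine lt_of_eq_of_lt ?_ h
      simp only [φ, Finset.mul_sum, ← Finset.sum_sub_distrib]
      refine Finset.sum_congr rfl fun i _ => ?_
      simp only [Pi.add_apply, Pi.smul_apply, smul_eq_mul, Fin.tail]
      push_cast
      ring
    obtain ⟨s, hlo, hhi⟩ := Order.exists_between_finsets
      (lo := insert 0 ((D.filter (fun d => d 0 < 0)).image (fun q => -φ q / (q 0 : ℚ))))
      (hi := (D.filter (fun d => 0 < d 0)).image (fun p => -φ p / (p 0 : ℚ))) (by
        intro x hx y hy
        obtain ⟨p, hp, rfl⟩ := Finset.mem_image.1 hy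
        obtain ⟨hp, hp0⟩ := Finset.mem_filter.1 hp
        have hp0' : (0 : ℚ) < p 0 := by exact_mod_cast hp0
        rcases Finset.mem_insert.1 hx with rfl | hx
        · exact div_pos (neg_pos.2 (hnonneg p hp hp0.le)) hp0'
        · obtain ⟨q, hq, rfl⟩ := Finset.mem_image.1 hx
          obtain ⟨hq, hq0⟩ := Finset.mem_filter.1 hq
          have hq0' : (q 0 : ℚ) < 0 := by exact_mod_cast hq0
          have := hpair p hp q hq hp0 hq0
          rw [lt_div_iff₀ hp0', div_mul_eq_mul_div, div_lt_iff_of_neg hq0']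
          linarith)
    have hs : 0 < s := hlo 0 (Finset.mem_insert_self _ _)
    refine ⟨Fin.cons s r, fun i => Fin.cases hs.le hr i, fun d hd => ?_⟩
    rw [Fin.sum_univ_succ]
    simp only [Fin.cons_zero, Fin.cons_succ]
    change s * (d 0 : ℚ) + φ d < 0
    rcases lt_trichotomy (d 0) 0 with h | h | h
    · have h' : (d 0 : ℚ) < 0 := by exact_mod_cast h
      have := hlo _ (Finset.mem_insert_of_mem
        (Finset.mem_image_of_mem _ (Finset.mem_filter.2 ⟨hd, h⟩)))
      rw [div_lt_iff_of_neg h'] at this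
      linarith
    · have := hnonneg d hd h.ge
      simpa [h] using this
    · have h' : (0 : ℚ) < d 0 := by exact_mod_cast h
      have := hhi _ (Finset.mem_image_of_mem _ (Finset.mem_filter.2 ⟨hd, h⟩))
      rw [lt_div_iff₀ h'] at this
      linarith

/-- Elements of the additive semigroup generated by `D` are sums of finite non-empty sequences
in `D`. -/
theorem exists_seq_of_mem_closure {M : Type*} [AddCommMonoid M] {D : Set M} {x : M}
    (hx : x ∈ AddSubsemigroup.closure D) :
    ∃ (m : ℕ) (d : ℕ → M), 0 < m ∧ (∀ t < m, d t ∈ D) ∧ ∑ t ∈ Finset.range m, d t = x := by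
  induction hx using AddSubsemigroup.closure_induction with
  | mem x hx => exact ⟨1, fun _ => x, one_pos, fun _ _ => hx, by simp⟩
  | add x y _ _ hx hy =>
    obtain ⟨m, d, hm, hd, rfl⟩ := hx
    obtain ⟨k, e, hk, he, rfl⟩ := hy
    refine ⟨m + k, fun t => if t < m then d t else e (t - m), by omega, ?_, ?_⟩
    · intro t ht
      by_cases h : t < m
      · simpa [h] using hd t h
      · simpa [h] using he (t - m) (by omega)
    · rw [Finset.sum_range_add]
      congr 1
      · exact Finset.sum_congr rfl fun t ht => by simp [Finset.mem_range.1 ht]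
      · exact Finset.sum_congr rfl fun t _ => by simp

/-- Repeating forever a sequence of self-loops of `l` with non-negative total effect gives an
infinite trace. -/
theorem not_terminating_of_nonneg_sum {n : ℕ} {L : Type} (V : VASS n L) (l : L) (m : ℕ)
    (e : ℕ → Upd n) (hm : 0 < m) (he : ∀ t < m, (l, e t, l) ∈ V.Trns)
    (hsum : 0 ≤ ∑ t ∈ Finset.range m, e t) : ¬ Terminating V := by
  let d : ℕ → Upd n := fun t => e (t % m)
  let f : ℕ → Upd n := fun k => ∑ t ∈ Finset.range k, d t
  have hfm : 0 ≤ f m := by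
    have : f m = ∑ t ∈ Finset.range m, e t :=
      Finset.sum_congr rfl fun t ht => by simp [d, Nat.mod_eq_of_lt (Finset.mem_range.1 ht)]
    rwa [this]
  have hper : ∀ k, f (m + k) = f m + f k := fun k => by
    simp [f, d, Finset.sum_range_add]
  let B : Fin n → ℤ := fun i => ∑ t ∈ Finset.range m, |f t i|
  have hB : ∀ k i, 0 ≤ B i + f k i := by
    intro k i
    induction k using Nat.strong_induction_on with
    | _ k ih =>
      by_cases hk : k < m
      · have h1 : |f k i| ≤ B i := Finset.single_le_sum (f := fun t => |f t i|)
          (fun t _ => abs_nonneg _) (Finset.mem_range.2 hk)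
        have h2 := neg_abs_le (f k i)
        linarith
      · obtain ⟨j, rfl⟩ := Nat.exists_eq_add_of_le (not_lt.1 hk)
        have h1 := ih j (by omega)
        have h2 : 0 ≤ f m i := hfm i
        rw [hper, Pi.add_apply]
        linarith
  refine fun h => h ⟨fun _ => l, fun k i => (B i + f k i).toNat, d, fun k => ⟨?_, fun i => ?_⟩⟩
  · exact he _ (Nat.mod_lt _ hm)
  · have h1 := hB k i
    have h2 := hB (k + 1) i
    have h3 : f (k + 1) i = f k i + d k i := by simp [f, Finset.sum_range_succ]
    simp only [Int.toNat_of_nonneg h1]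
    rw [Int.toNat_of_nonneg h2, h3, add_assoc]

/-- A non-negative linear form that decreases by at least one along every transition bounds the
length of finite traces. -/
theorem FinTrace.length_le {n : ℕ} {L : Type} {V : VASS n L} {k : ℕ} {ℓ : ℕ → L}
    {v : ℕ → Val n} {d : ℕ → Upd n} (h : FinTrace V k ℓ v d) (r : Fin n → ℚ)
    (hr : ∀ i, 0 ≤ r i) (hdec : ∀ t ∈ V.Trns, ∑ i, r i * (t.2.1 i : ℚ) ≤ -1) :
    (k : ℚ) ≤ ∑ i, r i * (v 0 i : ℚ) := by
  have key : ∀ j ≤ k, (j : ℚ) + ∑ i, r i * (v j i : ℚ) ≤ ∑ i, r i * (v 0 i : ℚ) := by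
    intro j
    induction j with
    | zero => simp
    | succ j ih =>
      intro hj
      obtain ⟨hmem, hval⟩ := h j hj
      have h1 : ∑ i, r i * (v (j + 1) i : ℚ)
          = ∑ i, r i * (v j i : ℚ) + ∑ i, r i * (d j i : ℚ) := by
        rw [← Finset.sum_add_distrib]
        refine Finset.sum_congr rfl fun i _ => ?_
        have : (v (j + 1) i : ℚ) = (v j i : ℚ) + (d j i : ℚ) := by exact_mod_cast hval i
        rw [this, mul_add]
      have h2 : ∑ i, r i * (d j i : ℚ) ≤ -1 := hdec _ hmem
      have h3 := ih (by omega)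
      push_cast
      linarith
  have h0 : 0 ≤ ∑ i, r i * (v k i : ℚ) :=
    Finset.sum_nonneg fun i _ => mul_nonneg (hr i) (Nat.cast_nonneg _)
  linarith [key k le_rfl]

/-- **Linear complexity of vector addition systems.** Every terminating VASS with
exactly one location (i.e. a VAS) has at most linear computational complexity:
there is a constant `C` with `comp_N(V) ≤ C·N` for all `N ≥ 1`. -/
theorem vas_linear_complexity {n : ℕ} {L : Type} (V : VASS n L)
    (hone : V.Locs.card = 1) (hterm : Terminating V) :
    ∃ C : ℕ, ∀ N : ℕ, 1 ≤ N → compN V N ≤ C * N := by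
  classical
  obtain ⟨l, hl⟩ := Finset.card_eq_one.1 hone
  have hloop : ∀ t ∈ V.Trns, t = (l, t.2.1, l) := by
    rintro ⟨a, d, b⟩ ht
    obtain ⟨ha, hb⟩ := V.valid _ ht
    simp only [hl, Finset.mem_singleton] at ha hb
    simp [ha, hb]
  obtain ⟨r, hr, hneg⟩ := exists_nonneg_form_neg n (V.Trns.image (fun t => t.2.1)) (by
    intro x hx h0
    obtain ⟨m, e, hm, he, rfl⟩ := exists_seq_of_mem_closure hx
    refine not_terminating_of_nonneg_sum V l m e hm (fun t ht => ?_) h0 hterm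
    obtain ⟨τ, hτ, hτe⟩ := Finset.mem_image.1 (Finset.mem_coe.1 (he t ht))
    rw [← hτe, ← hloop τ hτ]
    exact hτ)
  obtain ⟨K, hK⟩ := (insert 0 (V.Trns.image
    (fun t => -(∑ i, r i * (t.2.1 i : ℚ))⁻¹))).exists_le
  have hK0 : 0 ≤ K := hK 0 (Finset.mem_insert_self _ _)
  have hdec : ∀ t ∈ V.Trns, ∑ i, (K * r i) * (t.2.1 i : ℚ) ≤ -1 := by
    intro t ht
    have h1 := hneg _ (Finset.mem_image_of_mem _ ht)
    have h2 := hK _ (Finset.mem_insert_of_mem (Finset.mem_image_of_mem _ ht))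
    simp only [mul_assoc, ← Finset.mul_sum]
    calc _ ≤ -(∑ i, r i * (t.2.1 i : ℚ))⁻¹ * ∑ i, r i * (t.2.1 i : ℚ) :=
          mul_le_mul_of_nonpos_right h2 h1.le
      _ = -1 := by rw [neg_mul, inv_mul_cancel₀ h1.ne]
  refine ⟨⌈∑ i, K * r i⌉₊, fun N _ => csSup_le' ?_⟩
  rintro k ⟨ℓ, v, d, ⟨-, hv⟩, hk⟩
  have hKr : ∀ i, 0 ≤ K * r i := fun i => mul_nonneg hK0 (hr i)
  have h : (k : ℚ) ≤ (⌈∑ i, K * r i⌉₊ : ℚ) * N := calc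
    (k : ℚ) ≤ ∑ i, (K * r i) * (v 0 i : ℚ) := hk.length_le _ hKr hdec
    _ ≤ ∑ i, (K * r i) * (N : ℚ) := Finset.sum_le_sum fun i _ =>
        mul_le_mul_of_nonneg_left (Nat.cast_le.2 (hv i)) (hKr i)
    _ = (∑ i, K * r i) * N := by rw [Finset.sum_mul]
    _ ≤ _ := mul_le_mul_of_nonneg_right (Nat.le_ceil _) (Nat.cast_nonneg _)
  exact_mod_cast h

end VASSPaper
end

section
/- Ranking/witness dichotomy for a single transition: Let V be a VASS of dimension n and t ∈ Trns(V) a transition. Then exactly one of the following holds: (i) there exists a non-negative multi-cycle of V that contains transition t at least once; (ii) there exist r ∈ ℕ^n and z ∈ ℕ^{Locs(V)} such that the function f(l,v) = r^T v + z(l) is a quasi-ranking function for V that is ranking for t. -/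
namespace VASSPaper

variable {n : ℕ} {L : Type}

/-- **Farkas' lemma** for finitely many linear functionals over a linearly ordered field. -/
theorem exists_nonneg_combination_of_forall_nonpos {K W ι : Type*} [Field K] [LinearOrder K]
    [IsStrictOrderedRing K] [AddCommGroup W] [Module K W] [DecidableEq ι] (s : Finset ι) :
    ∀ (A : ι → W →ₗ[K] K) (b : W →ₗ[K] K),
      (∀ x, (∀ i ∈ s, A i x ≤ 0) → b x ≤ 0) →
      ∃ u : ι → K, (∀ i, 0 ≤ u i) ∧ b = ∑ i ∈ s, u i • A i := by
  induction s using Finset.induction_on with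
  | empty =>
    intro A b h
    refine ⟨0, fun _ => le_rfl, ?_⟩
    ext x
    have h₁ := h x (by simp)
    have h₂ := h (-x) (by simp)
    rw [map_neg] at h₂
    simpa using le_antisymm h₁ (by linarith)
  | insert a s ha ih =>
    intro A b h
    by_cases hb : ∀ x, (∀ i ∈ s, A i x ≤ 0) → b x ≤ 0
    · obtain ⟨u, hu, rfl⟩ := ih A b hb
      refine ⟨Function.update u a 0, fun i => ?_, ?_⟩
      · by_cases hi : i = a
        · subst hi; simp
        · simp [hi, hu]
      · rw [Finset.sum_insert ha]
        simp only [Function.update_self, zero_smul, zero_add]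
        refine Finset.sum_congr rfl fun i hi => ?_
        rw [Function.update_of_ne (ne_of_mem_of_not_mem hi ha)]
    · push Not at hb
      obtain ⟨y, hy, hby⟩ := hb
      have hay : 0 < A a y := by
        by_contra! hc
        exact absurd (h y fun i hi => (Finset.mem_insert.1 hi).elim (fun e => e ▸ hc) (hy i))
          (not_le.2 hby)
      set c := (A a y)⁻¹
      have hc0 : 0 < c := inv_pos.2 hay
      have hcy : c * A a y = 1 := inv_mul_cancel₀ hay.ne'
      obtain ⟨u, hu, hbu⟩ := ih (fun i => A i - (c * A i y) • A a) (b - (c * b y) • A a) (by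
        intro x hx
        have := h (x - (c * A a x) • y) (by
          intro i hi
          rcases Finset.mem_insert.1 hi with rfl | hi
          · simp only [map_sub, map_smul, smul_eq_mul]
            linear_combination (A i x) * (-hcy)
          · have := hx i hi
            simp only [LinearMap.sub_apply, LinearMap.smul_apply, smul_eq_mul] at this
            simp only [map_sub, map_smul, smul_eq_mul]
            linarith)
        simp only [map_sub, map_smul, smul_eq_mul] at this
        simp only [LinearMap.sub_apply, LinearMap.smul_apply, smul_eq_mul]
        linarith)
      refine ⟨Function.update u a (c * b y - ∑ i ∈ s, u i * (c * A i y)), fun i => ?_, ?_⟩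
      · by_cases hi : i = a
        · subst hi
          rw [Function.update_self, sub_nonneg]
          refine (Finset.sum_nonpos fun j hj => ?_).trans (mul_pos hc0 hby).le
          exact mul_nonpos_of_nonneg_of_nonpos (hu j)
            (mul_nonpos_of_nonneg_of_nonpos hc0.le (hy j hj))
        · simp [hi, hu]
      · have hcongr : ∀ w, ∑ i ∈ s, Function.update u a w i • A i = ∑ i ∈ s, u i • A i := fun w =>
          Finset.sum_congr rfl fun i hi => by
            rw [Function.update_of_ne (ne_of_mem_of_not_mem hi ha)]
        rw [Finset.sum_insert ha, Function.update_self, hcongr]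
        ext x
        have hx := LinearMap.congr_fun hbu x
        simp only [LinearMap.sub_apply, LinearMap.add_apply, LinearMap.smul_apply,
          LinearMap.sum_apply, smul_eq_mul, mul_sub, Finset.sum_sub_distrib] at hx ⊢
        rw [sub_mul, Finset.sum_mul]
        simp only [← mul_assoc] at hx ⊢
        linear_combination hx

/-- Finitely many rationals have a common positive denominator. -/
theorem exists_common_denominator {ι : Type*} (s : Finset ι) (f : ι → ℚ) :
    ∃ N : ℕ, 0 < N ∧ ∃ m : ι → ℤ, ∀ i ∈ s, (N : ℚ) * f i = m i := by
  classical
  refine ⟨∏ i ∈ s, (f i).den, Finset.prod_pos fun i _ => (f i).pos,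
    fun i => (∏ j ∈ s.erase i, (f j).den : ℕ) * (f i).num, fun i hi => ?_⟩
  rw [← Finset.mul_prod_erase s _ hi]
  push_cast
  linear_combination (∏ j ∈ s.erase i, ((f j).den : ℚ)) * (Rat.mul_den_eq_num (f i))

/-- A finite collection of non-empty paths whose start and end locations agree as multisets can
be reassembled into a multi-cycle that uses the same transitions. -/
theorem exists_multiCycle_of_paths (V : VASS n L) (k : ℕ) :
    ∀ P : List (List (Transition n L)), P.length = k →
      (∀ π ∈ P, IsPath V π ∧ π ≠ []) →
      (P.map fun π => π.getLast?.map fun t => t.2.2).Perm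
        (P.map fun π => π.head?.map fun t => t.1) →
      ∃ M, IsMultiCycle V M ∧ M.flatten.Perm P.flatten := by
  classical
  induction k with
  | zero =>
    intro P hP _ _
    obtain rfl := List.length_eq_zero_iff.1 hP
    exact ⟨[], by simp [IsMultiCycle], by simp⟩
  | succ k ih =>
    intro P hk hP hperm
    obtain ⟨π, P, rfl⟩ := List.exists_cons_of_length_eq_add_one hk
    have hk : P.length = k := by simpa using hk
    obtain ⟨hπ, hne⟩ := hP π (by simp)
    simp only [List.map_cons] at hperm
    by_cases hcyc : (π.head?.map fun t => t.1) = π.getLast?.map fun t => t.2.2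
    · rw [hcyc] at hperm
      obtain ⟨M, hM, hMP⟩ := ih P hk (fun ρ hρ => hP ρ (by simp [hρ])) hperm.cons_inv
      refine ⟨π :: M, ?_, by simpa using hMP.append_left π⟩
      intro C hC
      rcases List.mem_cons.1 hC with rfl | hC
      · exact ⟨hπ, hne, hcyc⟩
      · exact hM C hC
    · have hmem : (π.getLast?.map fun t => t.2.2) ∈ P.map fun π => π.head?.map fun t => t.1 := by
        have := hperm.subset List.mem_cons_self
        rcases List.mem_cons.1 this with h | h
        · exact absurd h.symm hcyc
        · exact h
      obtain ⟨ρ, hρ, hρπ⟩ := List.mem_map.1 hmem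
      have hPρ := List.perm_cons_erase hρ
      obtain ⟨hρpath, hρne⟩ := hP ρ (by simp [hρ])
      obtain ⟨M, hM, hMP⟩ := ih ((π ++ ρ) :: P.erase ρ)
        (by rw [← hk, hPρ.length_eq]; simp)
        (by
          intro C hC
          rcases List.mem_cons.1 hC with rfl | hC
          · refine ⟨⟨fun t ht => ?_, ?_⟩, by simp [hne]⟩
            · exact (List.mem_append.1 ht).elim (hπ.1 t) (hρpath.1 t)
            · refine List.isChain_append.2 ⟨hπ.2, hρpath.2, fun x hx y hy => ?_⟩
              rw [Option.mem_def.1 hx, Option.mem_def.1 hy] at hρπ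
              simpa using hρπ.symm
          · exact hP C (by simp [List.mem_of_mem_erase hC]))
        (by
          have h₁ := ((hPρ.map fun π => π.getLast?.map fun t => t.2.2).cons
            (π.getLast?.map fun t => t.2.2)).symm.trans (hperm.trans
            ((hPρ.map fun π => π.head?.map fun t => t.1).cons (π.head?.map fun t => t.1)))
          simp only [List.map_cons, hρπ] at h₁
          have h₂ := (h₁.trans (List.Perm.swap _ _ _)).cons_inv
          have e₁ : (π ++ ρ).getLast? = ρ.getLast? := List.getLast?_append_of_ne_nil _ hρne
          have e₂ : (π ++ ρ).head? = π.head? := List.head?_append_of_ne_nil _ hne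
          simpa only [List.map_cons, e₁, e₂] using h₂)
      refine ⟨M, hM, hMP.trans ?_⟩
      have := (hPρ.flatten).symm.append_left π
      simpa using this

theorem multiVal_eq_sum_flatten (M : List (List (Transition n L))) :
    multiVal M = (M.flatten.map fun t => t.2.1).sum := by
  induction M with
  | nil => simp [multiVal]
  | cons C M ih =>
    simp only [multiVal, List.map_cons, List.sum_cons, pathVal, List.flatten_cons,
      List.map_append, List.sum_append] at ih ⊢
    rw [ih]

/-- A multiset of transitions in which every location is entered as often as it is left is the
multiset of transitions of a multi-cycle. -/
theorem exists_multiCycle_of_balanced (V : VASS n L) (S : List (Transition n L))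
    (hS : ∀ t ∈ S, t ∈ V.Trns) (hbal : (S.map fun t => t.2.2).Perm (S.map fun t => t.1)) :
    ∃ M, IsMultiCycle V M ∧ M.flatten.Perm S := by
  obtain ⟨M, hM, hMP⟩ := exists_multiCycle_of_paths V _ (S.map fun t => [t]) rfl
    (by
      intro π hπ
      obtain ⟨t, ht, rfl⟩ := List.mem_map.1 hπ
      exact ⟨⟨by simpa using hS t ht, List.isChain_singleton _⟩, by simp⟩)
    (by simpa [List.map_map, Function.comp_def] using hbal.map some)
  refine ⟨M, hM, hMP.trans (List.Perm.of_eq ?_)⟩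
  clear hS hbal hMP
  induction S <;> simp_all

/-- The telescoping sum of a potential along a path. -/
theorem sum_potential_of_isPath (V : VASS n L) (z : L → ℤ) (π : List (Transition n L))
    (hπ : IsPath V π) (a b : Transition n L) (ha : π.head? = some a) (hb : π.getLast? = some b) :
    (π.map fun t => z t.2.2 - z t.1).sum = z b.2.2 - z a.1 := by
  induction π generalizing a with
  | nil => simp at ha
  | cons c π ih =>
    obtain rfl : c = a := by simpa using ha
    cases π with
    | nil =>
      obtain rfl : c = b := by simpa using hb
      simp
    | cons e π =>
      have hch := List.isChain_cons_cons.1 hπ.2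
      have := ih ⟨fun t ht => hπ.1 t (List.mem_cons_of_mem _ ht), hch.2⟩ e (by simp)
        (by simpa using hb)
      rw [List.map_cons, List.sum_cons, this, hch.1]
      ring

theorem IsMultiCycle.sum_potential {V : VASS n L} (z : L → ℤ) {M : List (List (Transition n L))}
    (hM : IsMultiCycle V M) : (M.flatten.map fun t => z t.2.2 - z t.1).sum = 0 := by
  induction M with
  | nil => simp
  | cons C M ih =>
    rw [List.flatten_cons, List.map_append, List.sum_append,
      ih fun D hD => hM D (List.mem_cons_of_mem _ hD), add_zero]
    obtain ⟨hp, hne, hcyc⟩ := hM C List.mem_cons_self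
    have h₁ := List.head?_eq_some_head hne
    have h₂ := List.getLast?_eq_some_getLast hne
    rw [h₁, h₂] at hcyc
    simp only [Option.map_some, Option.some.injEq] at hcyc
    rw [sum_potential_of_isPath V z C hp _ _ h₁ h₂, hcyc, sub_self]

/-- The change of an affine function along a transition. -/
def drift {R : Type*} [CommRing R] (r : Fin n → R) (z : L → R) (t : Transition n L) : R :=
  ∑ i, (t.2.1 i : R) * r i + z t.2.2 - z t.1

/-- A step of `V` changes the value of an affine function by its drift. -/
theorem Step.affine_eq {V : VASS n L} {s s' : L × Val n} {d : Upd n} (h : Step V s d s')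
    (r : Fin n → ℕ) (z : L → ℕ) :
    (((∑ i, r i * s'.2 i) + z s'.1 : ℕ) : ℤ) = ((∑ i, r i * s.2 i) + z s.1 : ℕ) +
      drift (fun i => (r i : ℤ)) (fun l => (z l : ℤ)) (s.1, d, s'.1) := by
  have : ∑ i, (r i : ℤ) * s'.2 i = ∑ i, (r i : ℤ) * s.2 i + ∑ i, d i * (r i : ℤ) := by
    rw [← Finset.sum_add_distrib]
    refine Finset.sum_congr rfl fun i _ => ?_
    rw [h.2 i]
    ring
  push_cast
  rw [this]
  simp only [drift, Int.cast_id]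
  ring

/-- Every transition can be taken from some state. -/
theorem exists_step {V : VASS n L} {t : Transition n L} (ht : t ∈ V.Trns) :
    ∃ v v' : Val n, Step V (t.1, v) t.2.1 (t.2.2, v') := by
  refine ⟨fun i => (-t.2.1 i).toNat, fun i => (t.2.1 i).toNat, ht, fun i => ?_⟩
  simp only
  omega

theorem quasiRanking_affine_iff (V : VASS n L) (r : Fin n → ℕ) (z : L → ℕ) :
    QuasiRanking V (fun s => (∑ i, r i * s.2 i) + z s.1) ↔
      ∀ t ∈ V.Trns, drift (fun i => (r i : ℤ)) (fun l => (z l : ℤ)) t ≤ 0 := by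
  constructor
  · intro h t ht
    obtain ⟨v, v', hs⟩ := exists_step ht
    have h₁ := h _ _ _ hs
    have h₂ := hs.affine_eq r z
    rw [← Int.ofNat_le] at h₁
    linarith
  · intro h s d s' hs
    have h₁ := h _ hs.1
    have h₂ := hs.affine_eq r z
    rw [← Int.ofNat_le]
    linarith

theorem rankingFor_affine_iff (V : VASS n L) (r : Fin n → ℕ) (z : L → ℕ) {t : Transition n L}
    (ht : t ∈ V.Trns) :
    RankingFor V (fun s => (∑ i, r i * s.2 i) + z s.1) t ↔
      drift (fun i => (r i : ℤ)) (fun l => (z l : ℤ)) t < 0 := by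
  constructor
  · intro h
    obtain ⟨v, v', hs⟩ := exists_step ht
    have h₁ := h _ _ _ hs rfl
    have h₂ := hs.affine_eq r z
    rw [← Int.ofNat_lt] at h₁
    linarith
  · rintro h s d s' hs rfl
    have h₂ := hs.affine_eq r z
    rw [← Int.ofNat_lt]
    linarith

theorem sum_drift (r : Fin n → ℤ) (z : L → ℤ) (S : List (Transition n L)) :
    (S.map (drift r z)).sum =
      ∑ i, (S.map fun t => t.2.1).sum i * r i + (S.map fun t => z t.2.2 - z t.1).sum := by
  induction S with
  | nil => simp
  | cons t S ih =>
    simp only [List.map_cons, List.sum_cons, ih, drift, Pi.add_apply, add_mul,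
      Finset.sum_add_distrib, Int.cast_id]
    ring

/-- A non-negative multi-cycle through `t` excludes a ranking function for `t`. -/
theorem IsMultiCycle.not_mem_flatten_of_drift_neg {V : VASS n L} {t : Transition n L}
    {M : List (List (Transition n L))} (hM : IsMultiCycle V M) (hval : ∀ i, 0 ≤ multiVal M i)
    {r : Fin n → ℤ} {z : L → ℤ} (hr : ∀ i, 0 ≤ r i) (hq : ∀ t ∈ V.Trns, drift r z t ≤ 0)
    (ht : drift r z t < 0) : t ∉ M.flatten := by
  classical
  intro hmem
  have h₁ := sum_drift r z M.flatten
  rw [hM.sum_potential z, add_zero, ← multiVal_eq_sum_flatten] at h₁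
  have h₂ : 0 ≤ ∑ i, multiVal M i * r i :=
    Finset.sum_nonneg fun i _ => mul_nonneg (hval i) (hr i)
  have hle : ∀ t ∈ M.flatten, drift r z t ≤ 0 := by
    intro t ht
    obtain ⟨C, hC, htC⟩ := List.mem_flatten.1 ht
    exact hq t ((hM C hC).1.1 t htC)
  have h₃ : ((M.flatten.erase t).map (drift r z)).sum ≤ 0 :=
    List.sum_le_card_nsmul _ 0 (fun x hx => by
      obtain ⟨s, hs, rfl⟩ := List.mem_map.1 hx
      exact hle s (List.mem_of_mem_erase hs)) |>.trans_eq (smul_zero _)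
  have h₄ := ((List.perm_cons_erase hmem).map (drift r z)).sum_eq
  rw [List.map_cons, List.sum_cons] at h₄
  linarith

/-- The drift of a transition as a linear functional of the coefficients. -/
def driftLinear (t : Transition n L) : ((Fin n → ℚ) × (L → ℚ)) →ₗ[ℚ] ℚ where
  toFun x := drift x.1 x.2 t
  map_add' x y := by
    simp only [drift, Prod.fst_add, Prod.snd_add, Pi.add_apply, mul_add, Finset.sum_add_distrib]
    ring
  map_smul' c x := by
    simp only [drift, Prod.smul_fst, Prod.smul_snd, Pi.smul_apply, smul_eq_mul, RingHom.id_apply,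
      mul_sub, mul_add, Finset.mul_sum]
    congr 2
    exact Finset.sum_congr rfl fun i _ => by ring

/-- Rational coefficients with the ranking inequalities can be replaced by natural ones. -/
theorem exists_nat_drift_of_rat (V : VASS n L) {t : Transition n L} (ht : t ∈ V.Trns)
    {r : Fin n → ℚ} {z : L → ℚ} (hr : ∀ i, 0 ≤ r i) (hq : ∀ t ∈ V.Trns, drift r z t ≤ 0)
    (hlt : drift r z t < 0) :
    ∃ (r : Fin n → ℕ) (z : L → ℕ),
      (∀ t ∈ V.Trns, drift (fun i => (r i : ℤ)) (fun l => (z l : ℤ)) t ≤ 0) ∧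
      drift (fun i => (r i : ℤ)) (fun l => (z l : ℤ)) t < 0 := by
  obtain ⟨N, hN, m, hm⟩ :=
    exists_common_denominator (Finset.univ.disjSum V.Locs) (Sum.elim r z)
  have hN' : (0 : ℚ) < N := by exact_mod_cast hN
  have hmr : ∀ i, (N : ℚ) * r i = m (Sum.inl i) := fun i => hm (Sum.inl i) (by simp)
  have hmz : ∀ l ∈ V.Locs, (N : ℚ) * z l = m (Sum.inr l) := fun l hl => hm (Sum.inr l) (by simpa)
  have hr0 : ∀ i, 0 ≤ m (Sum.inl i) := fun i => by
    have := mul_nonneg hN'.le (hr i)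
    rw [hmr] at this
    exact_mod_cast this
  let c : ℤ := ∑ l ∈ V.Locs, |m (Sum.inr l)|
  have hz0 : ∀ l ∈ V.Locs, 0 ≤ m (Sum.inr l) + c := fun l hl => by
    have h₁ : |m (Sum.inr l)| ≤ c :=
      Finset.single_le_sum (f := fun l => |m (Sum.inr l)|) (fun _ _ => abs_nonneg _) hl
    have h₂ := neg_abs_le (m (Sum.inr l))
    linarith
  have key : ∀ t ∈ V.Trns, ((drift (fun i => (((m (Sum.inl i)).toNat : ℕ) : ℤ))
      (fun l => (((m (Sum.inr l) + c).toNat : ℕ) : ℤ)) t : ℤ) : ℚ) = N * drift r z t := by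
    intro t ht
    obtain ⟨h₁, h₂⟩ := V.valid t ht
    simp only [drift, Int.toNat_of_nonneg (hr0 _), Int.toNat_of_nonneg (hz0 _ h₁),
      Int.toNat_of_nonneg (hz0 _ h₂), Int.cast_id]
    push_cast
    rw [mul_sub, mul_add, Finset.mul_sum, hmz _ h₁, hmz _ h₂]
    simp only [mul_left_comm (N : ℚ), hmr]
    ring
  refine ⟨fun i => (m (Sum.inl i)).toNat, fun l => (m (Sum.inr l) + c).toNat, fun t ht => ?_, ?_⟩
  · have := mul_nonpos_of_nonneg_of_nonpos hN'.le (hq t ht)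
    rw [← key t ht] at this
    exact_mod_cast this
  · have := mul_neg_of_pos_of_neg hN' hlt
    rw [← key t ht] at this
    exact_mod_cast this

/-- If no rational affine function ranks `t`, there is a non-negative rational circulation with
non-negative value and positive weight on `t`. -/
theorem exists_rat_circulation [DecidableEq L] (V : VASS n L) {t : Transition n L}
    (ht : t ∈ V.Trns)
    (h : ∀ (r : Fin n → ℚ) (z : L → ℚ), (∀ i, 0 ≤ r i) → (∀ t ∈ V.Trns, drift r z t ≤ 0) →
      0 ≤ drift r z t) :
    ∃ μ : Transition n L → ℚ, (∀ s, 0 ≤ μ s) ∧ 0 < μ t ∧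
      (∀ i, 0 ≤ ∑ s ∈ V.Trns, μ s * s.2.1 i) ∧
      ∀ l, ∑ s ∈ V.Trns, μ s * ((if s.2.2 = l then 1 else 0) - if s.1 = l then 1 else 0) = 0 := by
  obtain ⟨u, hu, hb⟩ := exists_nonneg_combination_of_forall_nonpos
    (V.Trns.disjSum (Finset.univ : Finset (Fin n)))
    (Sum.elim driftLinear fun i => -(LinearMap.proj i ∘ₗ LinearMap.fst ℚ (Fin n → ℚ) (L → ℚ)))
    (-driftLinear t) (by
      intro x hx
      have := h x.1 x.2 (fun i => by simpa using hx (Sum.inr i) (by simp))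
        (fun s hs => hx (Sum.inl s) (by simpa using hs))
      exact neg_nonpos.2 this)
  have hb' : ∀ (r : Fin n → ℚ) (z : L → ℚ), -drift r z t =
      ∑ s ∈ V.Trns, u (Sum.inl s) * drift r z s - ∑ i, u (Sum.inr i) * r i := by
    intro r z
    have := LinearMap.congr_fun hb (r, z)
    simpa [Finset.sum_disjSum, driftLinear, sub_eq_add_neg] using this
  have hsum : ∀ (r : Fin n → ℚ) (z : L → ℚ),
      ∑ s ∈ V.Trns, (u (Sum.inl s) + if s = t then 1 else 0) * drift r z s =
        ∑ i, u (Sum.inr i) * r i := by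
    intro r z
    simp only [add_mul, ite_mul, one_mul, zero_mul, Finset.sum_add_distrib, Finset.sum_ite_eq',
      ht, if_true]
    linarith [hb' r z]
  refine ⟨fun s => u (Sum.inl s) + if s = t then 1 else 0, fun s => ?_, ?_, fun i => ?_,
    fun l => ?_⟩
  · have := hu (Sum.inl s)
    dsimp only
    split_ifs <;> linarith
  · have := hu (Sum.inl t)
    simp only [if_true]
    linarith
  · have := hsum (Pi.single i 1) 0
    simp only [drift, Pi.single_apply, mul_ite, mul_one, mul_zero, Finset.sum_ite_eq',
      Finset.mem_univ, if_true, Pi.zero_apply, add_zero, sub_zero] at this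
    rw [this]
    exact hu _
  · have := hsum 0 (Pi.single l 1)
    simpa [drift, Pi.single_apply] using this

/-- A non-negative integral circulation is realised by a multi-cycle. -/
theorem exists_multiCycle_of_circulation [DecidableEq L] (V : VASS n L)
    (μ : Transition n L → ℕ)
    (hμ : ∀ l, ∑ s ∈ V.Trns, (μ s : ℤ) *
      ((if s.2.2 = l then 1 else 0) - if s.1 = l then 1 else 0) = 0) :
    ∃ M, IsMultiCycle V M ∧ (∀ i, multiVal M i = ∑ s ∈ V.Trns, (μ s : ℤ) * s.2.1 i) ∧
      ∀ s ∈ V.Trns, (M.map fun C => C.count s).sum = μ s := by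
  let S : Multiset (Transition n L) := ∑ s ∈ V.Trns, Multiset.replicate (μ s) s
  have hcount : ∀ f : Transition n L → L, ∀ l,
      (S.map f).count l = ∑ s ∈ V.Trns, μ s * if f s = l then 1 else 0 := by
    intro f l
    rw [show S.map f = ∑ s ∈ V.Trns, (Multiset.replicate (μ s) s).map f from
      map_sum (Multiset.mapAddMonoidHom f) _ _, Multiset.count_sum']
    simp [Multiset.map_replicate, Multiset.count_replicate]
  have hbal : S.map (fun t => t.2.2) = S.map fun t => t.1 := by
    ext l
    have := hμ l
    simp only [mul_sub, Finset.sum_sub_distrib, sub_eq_zero] at this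
    rw [hcount, hcount]
    exact_mod_cast this
  obtain ⟨M, hM, hMS⟩ := exists_multiCycle_of_balanced V S.toList
    (by
      intro t ht
      rw [Multiset.mem_toList, Multiset.mem_sum] at ht
      obtain ⟨s, hs, hts⟩ := ht
      exact Multiset.eq_of_mem_replicate hts ▸ hs)
    (by
      rw [← Multiset.coe_eq_coe, ← Multiset.map_coe, ← Multiset.map_coe, Multiset.coe_toList, hbal])
  have hMS' : (M.flatten : Multiset (Transition n L)) = S := by
    rw [← S.coe_toList, Multiset.coe_eq_coe]
    exact hMS
  refine ⟨M, hM, fun i => ?_, fun s hs => ?_⟩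
  · rw [multiVal_eq_sum_flatten, ← Multiset.sum_coe, ← Multiset.map_coe, hMS',
      show S.map (fun t => t.2.1) = ∑ s ∈ V.Trns, (Multiset.replicate (μ s) s).map fun t => t.2.1
        from map_sum (Multiset.mapAddMonoidHom _) _ _, Multiset.sum_sum]
    simp [Multiset.map_replicate, Finset.sum_apply]
  · have hflat : M.flatten.count s = S.count s := by
      rw [← hMS', Multiset.coe_count]
      congr
      exact lawful_beq_subsingleton _ _
    rw [← List.count_flatten, hflat, Multiset.count_sum']
    simp [Multiset.count_replicate, hs]

/-- **Ranking/witness dichotomy for a single transition.** For every transition `t` of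
`V`, exactly one of the following holds: (i) there is a non-negative multi-cycle of
`V` containing `t` at least once; (ii) there are `r ∈ ℕⁿ` and `z ∈ ℕ^{Locs(V)}` such
that `f(l,v) = rᵀv + z(l)` is a quasi-ranking function for `V` that is ranking
for `t`. -/
theorem ranking_or_witness_dichotomy {n : ℕ} {L : Type} [DecidableEq L]
    (V : VASS n L) (t : Transition n L) (ht : t ∈ V.Trns) :
    Xor'
      (∃ M, IsMultiCycle V M ∧ (∀ i, 0 ≤ multiVal M i) ∧
        1 ≤ (M.map (fun C => C.count t)).sum)
      (∃ (r : Fin n → ℕ) (z : L → ℕ),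
        QuasiRanking V (fun s => (∑ i, r i * s.2 i) + z s.1) ∧
        RankingFor V (fun s => (∑ i, r i * s.2 i) + z s.1) t) := by
  have hcast : ∀ r : Fin n → ℕ, ∀ i, (0 : ℤ) ≤ r i := fun r i => Int.natCast_nonneg _
  by_cases h : ∀ (r : Fin n → ℚ) (z : L → ℚ), (∀ i, 0 ≤ r i) →
      (∀ t ∈ V.Trns, drift r z t ≤ 0) → 0 ≤ drift r z t
  · obtain ⟨μ, hμ0, hμt, hμv, hμb⟩ := exists_rat_circulation V ht h
    obtain ⟨N, hN, m, hm⟩ := exists_common_denominator V.Trns μ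
    have hN' : (0 : ℚ) < N := by exact_mod_cast hN
    have hm' : ∀ s ∈ V.Trns, (((m s).toNat : ℤ) : ℚ) = N * μ s := by
      intro s hs
      have h₀ := mul_nonneg hN'.le (hμ0 s)
      rw [hm s hs] at h₀ ⊢
      rw [Int.toNat_of_nonneg (by exact_mod_cast h₀)]
    obtain ⟨M, hM, hMv, hMc⟩ := exists_multiCycle_of_circulation V (fun s => (m s).toNat) (by
      intro l
      have := congrArg (fun x => (N : ℚ) * x) (hμb l)
      simp only [Finset.mul_sum, ← mul_assoc, mul_zero] at this
      rw [Finset.sum_congr rfl fun s hs => by rw [← hm' s hs]] at this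
      exact_mod_cast this)
    have hval : ∀ i, 0 ≤ multiVal M i := by
      intro i
      have := mul_nonneg hN'.le (hμv i)
      simp only [Finset.mul_sum, ← mul_assoc] at this
      rw [Finset.sum_congr rfl fun s hs => by rw [← hm' s hs]] at this
      rw [hMv]
      exact_mod_cast this
    have hpos : 1 ≤ (M.map fun C => C.count t).sum := by
      rw [hMc t ht]
      have := mul_pos hN' hμt
      rw [← hm' t ht] at this
      exact_mod_cast this
    refine Or.inl ⟨⟨M, hM, hval, hpos⟩, ?_⟩
    rintro ⟨r, z, hq, hr⟩
    refine hM.not_mem_flatten_of_drift_neg hval (hcast r) ((quasiRanking_affine_iff V r z).1 hq)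
      ((rankingFor_affine_iff V r z ht).1 hr) (List.count_pos_iff.1 ?_)
    rw [List.count_flatten]
    exact hpos
  · push Not at h
    obtain ⟨r, z, hr, hq, hlt⟩ := h
    obtain ⟨r, z, hq, hlt⟩ := exists_nat_drift_of_rat V ht hr hq hlt
    refine Or.inr ⟨⟨r, z, (quasiRanking_affine_iff V r z).2 hq,
      (rankingFor_affine_iff V r z ht).2 hlt⟩, ?_⟩
    rintro ⟨M, hM, hval, hpos⟩
    refine hM.not_mem_flatten_of_drift_neg hval (hcast r) hq hlt (List.count_pos_iff.1 ?_)
    rw [List.count_flatten]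
    exact hpos

end VASSPaper
end
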